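/- Up to equivalence, there are exactly two fine gradings on K₁₀: the ℤ²-grading Γ¹_{K₁₀}(ℤ²;(1,0),(0,1)) and the (ℤ×ℤ/2)-grading Γ²_{K₁₀}(ℤ×ℤ/2;(1,0̄),(0,1̄)). That is, each of these two gradings is fine, they are not equivalent to each other, and every fine grading on K₁₀ by an abelian group is equivalent to one of them. -/

import Mathlib

open scoped TensorProduct
noncomputable section
namespace Kac

/-! ### Superalgebra isomorphisms and automorphisms -/

@[ext]
structure SuperIso (S A B : Type) [CommRing S]
    [AddCommGroup A] [Module S A] [Mul A]
    [AddCommGroup B] [Module S B] [Mul B]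
    (evA odA : Submodule S A) (evB odB : Submodule S B) : Type where
  e : A ≃ₗ[S] B
  map_mul' : ∀ x y : A, e (x * y) = e x * e y
  map_even : evA.map e.toLinearMap = evB
  map_odd : odA.map e.toLinearMap = odB

abbrev SuperAut (S A : Type) [CommRing S] [AddCommGroup A] [Module S A] [Mul A]
    (ev od : Submodule S A) := SuperIso S A A ev od ev od

namespace SuperAut

variable {S A : Type} [CommRing S] [AddCommGroup A] [Module S A] [Mul A]
variable {ev od : Submodule S A}

private lemma map_symm {f : A ≃ₗ[S] A} {p : Submodule S A}
    (h : p.map f.toLinearMap = p) : p.map f.symm.toLinearMap = p := by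
  have h2 : f.symm.toLinearMap.comp f.toLinearMap = LinearMap.id := by
    ext x; simp
  calc p.map f.symm.toLinearMap
      = (p.map f.toLinearMap).map f.symm.toLinearMap := by rw [h]
    _ = p.map (f.symm.toLinearMap.comp f.toLinearMap) := by
        rw [Submodule.map_comp]
    _ = p := by rw [h2, Submodule.map_id]

instance : Group (SuperAut S A ev od) where
  one := ⟨LinearEquiv.refl S A, fun _ _ => rfl, Submodule.map_id _, Submodule.map_id _⟩
  mul f g := ⟨g.e.trans f.e,
    fun x y => by simp [LinearEquiv.trans_apply, g.map_mul', f.map_mul'],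
    by rw [LinearEquiv.coe_trans, Submodule.map_comp, g.map_even, f.map_even],
    by rw [LinearEquiv.coe_trans, Submodule.map_comp, g.map_odd, f.map_odd]⟩
  inv f := ⟨f.e.symm,
    fun x y => f.e.injective <| by simp [f.map_mul'],
    map_symm f.map_even, map_symm f.map_odd⟩
  mul_assoc f g h := by apply SuperIso.ext; apply LinearEquiv.ext; intro x; rfl
  one_mul f := by apply SuperIso.ext; apply LinearEquiv.ext; intro x; rfl
  mul_one f := by apply SuperIso.ext; apply LinearEquiv.ext; intro x; rfl
  inv_mul_cancel f := by
    apply SuperIso.ext; apply LinearEquiv.ext; intro x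
    exact f.e.symm_apply_apply x

end SuperAut

/-- The predicate that a pair of submodules `ev`, `od` makes a non-unital
(possibly non-associative) algebra `B` into a superalgebra. -/
def IsSuperalgebra (S B : Type) [CommRing S] [NonUnitalNonAssocRing B] [Module S B]
    (ev od : Submodule S B) : Prop :=
  ev ⊔ od = ⊤ ∧ ev ⊓ od = ⊥ ∧
  (∀ x ∈ ev, ∀ y ∈ ev, x * y ∈ ev) ∧ (∀ x ∈ ev, ∀ y ∈ od, x * y ∈ od) ∧
  (∀ x ∈ od, ∀ y ∈ ev, x * y ∈ od) ∧ (∀ x ∈ od, ∀ y ∈ od, x * y ∈ ev)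

/-! ### Submodules given by vanishing of coordinates -/

def stdSub (S R : Type) [Semiring S] [AddCommGroup R] [Module S R] (n : ℕ)
    (s : Set (Fin n)) : Submodule S (Fin n → R) where
  carrier := {x | ∀ i, i ∉ s → x i = 0}
  add_mem' := fun {a b} ha hb i hi => by
    simp [Pi.add_apply, ha i hi, hb i hi]
  zero_mem' := fun i _ => rfl
  smul_mem' := fun c x hx i hi => by
    simp [Pi.smul_apply, hx i hi]

/-! ### Gradings by abelian groups -/

section Gradings

variable {G H S A : Type} [CommGroup G] [CommGroup H] [CommRing S]
  [AddCommGroup A] [Module S A] [Mul A]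

/-- `comp` is a `G`-grading of the superalgebra `(A, ev, od)`. -/
def IsSuperGrading (ev od : Submodule S A) (comp : G → Submodule S A) : Prop :=
  (letI := Classical.decEq G; DirectSum.IsInternal comp) ∧
  (∀ (g h : G) (x y : A), x ∈ comp g → y ∈ comp h → x * y ∈ comp (g * h)) ∧
  (∀ g, comp g = (comp g ⊓ ev) ⊔ (comp g ⊓ od))

/-- The grading with homogeneous elements `w i` of degrees `d i`. -/
def gradingOf (S : Type) {A G : Type} [CommRing S] [AddCommGroup A] [Module S A]
    [CommGroup G] {n : ℕ} (w : Fin n → A) (d : Fin n → G) : G → Submodule S A :=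
  fun g => Submodule.span S (w '' {i | d i = g})

/-- Isomorphism of two `G`-gradings on a superalgebra. -/
def GradIso (ev od : Submodule S A) (comp comp' : G → Submodule S A) : Prop :=
  ∃ φ : SuperAut S A ev od, ∀ g, (comp g).map φ.e.toLinearMap = comp' g

/-- `Δ` refines `Γ`. -/
def Refines (Δ : H → Submodule S A) (Γ : G → Submodule S A) : Prop :=
  ∀ h, Δ h ≠ ⊥ → ∃ g, Δ h ≤ Γ g

/-- Equivalence of a `G`-grading and an `H`-grading on a superalgebra. -/
def GradEquiv (ev od : Submodule S A) (Γ : G → Submodule S A)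
    (Δ : H → Submodule S A) : Prop :=
  ∃ φ : SuperAut S A ev od, ∃ α : {g : G // Γ g ≠ ⊥} → {h : H // Δ h ≠ ⊥},
    Function.Bijective α ∧
    ∀ g : {g : G // Γ g ≠ ⊥}, (Γ g.1).map φ.e.toLinearMap = Δ (α g).1

/-- A grading is fine if any grading refining it has the same nonzero
homogeneous components. -/
def IsFine (ev od : Submodule S A) (Γ : G → Submodule S A) : Prop :=
  ∀ (H : Type) (_ : CommGroup H) (Δ : H → Submodule S A),
    IsSuperGrading ev od Δ → Refines Δ Γ →
      {p : Submodule S A | p ≠ ⊥ ∧ ∃ h, Δ h = p} =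
      {p : Submodule S A | p ≠ ⊥ ∧ ∃ g, Γ g = p}

end Gradings

/-! ### SL₂ and the semidirect product with C₂ -/

abbrev SL2 (R : Type) [CommRing R] := Matrix.SpecialLinearGroup (Fin 2) R

def swapAut (M : Type) [Monoid M] : MulAut (M × M) := MulEquiv.prodComm

lemma swapAut_sq (M : Type) [Monoid M] : swapAut M * swapAut M = 1 :=
  MulEquiv.ext fun _ => rfl

/-- The action of `C₂ = Multiplicative (ZMod 2)` on `M × M` by swapping the factors. -/
def swapHom (M : Type) [Group M] : Multiplicative (ZMod 2) →* MulAut (M × M) :=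
  MonoidHom.mk' (fun c => if c.toAdd = 0 then 1 else swapAut M) (by
    intro a b
    have key : ∀ c : Multiplicative (ZMod 2),
        c = Multiplicative.ofAdd 0 ∨ c = Multiplicative.ofAdd 1 := by decide
    rcases key a with rfl | rfl <;> rcases key b with rfl | rfl <;>
      simp [← ofAdd_add, swapAut_sq] <;> exact fun h => absurd (by decide) h)

end Kac
/-! ### The (base-changed) Kaplansky superalgebra `K₃ ⊗ R` -/

namespace Kac

section Algebras

variable (F : Type) [Field F] (R : Type) [CommRing R] [Algebra F R]

/-- Coordinates: `0 ↦ a`, `1 ↦ u`, `2 ↦ v`. -/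
def K3A (F : Type) [Field F] (R : Type) [CommRing R] [Algebra F R] : Type := Fin 3 → R

instance : AddCommGroup (K3A F R) := Pi.addCommGroup
instance (S : Type) [Semiring S] [Module S R] : Module S (K3A F R) := Pi.module _ _ _

namespace K3A
variable {F R}

def mulFun (x y : K3A F R) : K3A F R := fun i =>
  match i with
  | ⟨0, _⟩ => x 0 * y 0 + (x 1 * y 2 - x 2 * y 1)
  | ⟨1, _⟩ => algebraMap F R 2⁻¹ * (x 0 * y 1 + y 0 * x 1)
  | ⟨2, _⟩ => algebraMap F R 2⁻¹ * (x 0 * y 2 + y 0 * x 2)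

instance : Mul (K3A F R) := ⟨mulFun⟩

lemma mul_def (x y : K3A F R) : x * y = mulFun x y := rfl

@[simp] lemma add_apply (x y : K3A F R) (i : Fin 3) : (x + y) i = x i + y i := rfl
@[simp] lemma sub_apply (x y : K3A F R) (i : Fin 3) : (x - y) i = x i - y i := rfl
@[simp] lemma neg_apply (x : K3A F R) (i : Fin 3) : (-x) i = -(x i) := rfl
@[simp] lemma zero_apply (i : Fin 3) : (0 : K3A F R) i = 0 := rfl
@[simp] lemma smul_apply (S : Type) [Semiring S] [Module S R] (c : S) (x : K3A F R) (i : Fin 3) :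
    (c • x) i = c • (x i) := rfl

variable (F R)

/-- The even part `R·a`. -/
def even (S : Type) [Semiring S] [Module S R] : Submodule S (K3A F R) := stdSub S R 3 {0}
/-- The odd part `W ⊗ R`. -/
def odd (S : Type) [Semiring S] [Module S R] : Submodule S (K3A F R) := stdSub S R 3 {1, 2}

/-- The element `a`. -/
def aE : K3A F R := ![1, 0, 0]
/-- The element of `W ⊗ R` with coordinates `w` in the symplectic basis `{u, v}`. -/
def wE (w : Fin 2 → R) : K3A F R := ![0, w 0, w 1]

end K3A

/-- `J(W) ⊗ R`; coordinates: `0 ↦ 1`, `1 ↦ u`, `2 ↦ v`. -/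
def JW1A (R : Type) [CommRing R] : Type := Fin 3 → R

instance : AddCommGroup (JW1A R) := Pi.addCommGroup
instance (S : Type) [Semiring S] [Module S R] : Module S (JW1A R) := Pi.module _ _ _

namespace JW1A
variable {R}

def mulFun (x y : JW1A R) : JW1A R := fun i =>
  match i with
  | ⟨0, _⟩ => x 0 * y 0 + (x 1 * y 2 - x 2 * y 1)
  | ⟨1, _⟩ => x 0 * y 1 + y 0 * x 1
  | ⟨2, _⟩ => x 0 * y 2 + y 0 * x 2

instance : Mul (JW1A R) := ⟨mulFun⟩

lemma mul_def (x y : JW1A R) : x * y = mulFun x y := rfl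

@[simp] lemma add_apply (x y : JW1A R) (i : Fin 3) : (x + y) i = x i + y i := rfl
@[simp] lemma sub_apply (x y : JW1A R) (i : Fin 3) : (x - y) i = x i - y i := rfl
@[simp] lemma neg_apply (x : JW1A R) (i : Fin 3) : (-x) i = -(x i) := rfl
@[simp] lemma zero_apply (i : Fin 3) : (0 : JW1A R) i = 0 := rfl
@[simp] lemma smul_apply (S : Type) [Semiring S] [Module S R] (c : S) (x : JW1A R) (i : Fin 3) :
    (c • x) i = c • (x i) := rfl

variable (R)

def even (S : Type) [Semiring S] [Module S R] : Submodule S (JW1A R) := stdSub S R 3 {0}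
def odd (S : Type) [Semiring S] [Module S R] : Submodule S (JW1A R) := stdSub S R 3 {1, 2}

def oneE : JW1A R := ![1, 0, 0]
def wE (w : Fin 2 → R) : JW1A R := ![0, w 0, w 1]

end JW1A

/-- `(K₃ × K₃) ⊗ R`; coordinates `0,1,2` for the first copy (`a,u,v`),
`3,4,5` for the second copy. -/
def K33A (F : Type) [Field F] (R : Type) [CommRing R] [Algebra F R] : Type := Fin 6 → R

instance : AddCommGroup (K33A F R) := Pi.addCommGroup
instance (S : Type) [Semiring S] [Module S R] : Module S (K33A F R) := Pi.module _ _ _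

namespace K33A
variable {F R}

def mulFun (x y : K33A F R) : K33A F R := fun i =>
  match i with
  | ⟨0, _⟩ => x 0 * y 0 + (x 1 * y 2 - x 2 * y 1)
  | ⟨1, _⟩ => algebraMap F R 2⁻¹ * (x 0 * y 1 + y 0 * x 1)
  | ⟨2, _⟩ => algebraMap F R 2⁻¹ * (x 0 * y 2 + y 0 * x 2)
  | ⟨3, _⟩ => x 3 * y 3 + (x 4 * y 5 - x 5 * y 4)
  | ⟨4, _⟩ => algebraMap F R 2⁻¹ * (x 3 * y 4 + y 3 * x 4)
  | ⟨5, _⟩ => algebraMap F R 2⁻¹ * (x 3 * y 5 + y 3 * x 5)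

instance : Mul (K33A F R) := ⟨mulFun⟩

lemma mul_def (x y : K33A F R) : x * y = mulFun x y := rfl

@[simp] lemma add_apply (x y : K33A F R) (i : Fin 6) : (x + y) i = x i + y i := rfl
@[simp] lemma sub_apply (x y : K33A F R) (i : Fin 6) : (x - y) i = x i - y i := rfl
@[simp] lemma neg_apply (x : K33A F R) (i : Fin 6) : (-x) i = -(x i) := rfl
@[simp] lemma zero_apply (i : Fin 6) : (0 : K33A F R) i = 0 := rfl
@[simp] lemma smul_apply (S : Type) [Semiring S] [Module S R] (c : S) (x : K33A F R) (i : Fin 6) :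
    (c • x) i = c • (x i) := rfl

variable (F R)

def even (S : Type) [Semiring S] [Module S R] : Submodule S (K33A F R) := stdSub S R 6 {0, 3}
def odd (S : Type) [Semiring S] [Module S R] : Submodule S (K33A F R) := stdSub S R 6 {1, 2, 4, 5}

/-- The element `(a, 0)`. -/
def aLeft : K33A F R := ![1, 0, 0, 0, 0, 0]
/-- The element `(0, a)`. -/
def aRight : K33A F R := ![0, 0, 0, 1, 0, 0]
/-- The element `(v, w)` of the odd part, `v, w ∈ W ⊗ R`. -/
def oddE (w w' : Fin 2 → R) : K33A F R := ![0, w 0, w 1, 0, w' 0, w' 1]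
/-- The exchange automorphism `(x, y) ↦ (y, x)`. -/
def swapFun (x : K33A F R) : K33A F R := fun i =>
  match i with
  | ⟨0, _⟩ => x 3
  | ⟨1, _⟩ => x 4
  | ⟨2, _⟩ => x 5
  | ⟨3, _⟩ => x 0
  | ⟨4, _⟩ => x 1
  | ⟨5, _⟩ => x 2

end K33A

/-- `(J(W) × J(W)) ⊗ R`. -/
def JW2A (R : Type) [CommRing R] : Type := Fin 6 → R

instance : AddCommGroup (JW2A R) := Pi.addCommGroup
instance (S : Type) [Semiring S] [Module S R] : Module S (JW2A R) := Pi.module _ _ _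

namespace JW2A
variable {R}

def mulFun (x y : JW2A R) : JW2A R := fun i =>
  match i with
  | ⟨0, _⟩ => x 0 * y 0 + (x 1 * y 2 - x 2 * y 1)
  | ⟨1, _⟩ => x 0 * y 1 + y 0 * x 1
  | ⟨2, _⟩ => x 0 * y 2 + y 0 * x 2
  | ⟨3, _⟩ => x 3 * y 3 + (x 4 * y 5 - x 5 * y 4)
  | ⟨4, _⟩ => x 3 * y 4 + y 3 * x 4
  | ⟨5, _⟩ => x 3 * y 5 + y 3 * x 5

instance : Mul (JW2A R) := ⟨mulFun⟩

lemma mul_def (x y : JW2A R) : x * y = mulFun x y := rfl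

@[simp] lemma add_apply (x y : JW2A R) (i : Fin 6) : (x + y) i = x i + y i := rfl
@[simp] lemma sub_apply (x y : JW2A R) (i : Fin 6) : (x - y) i = x i - y i := rfl
@[simp] lemma neg_apply (x : JW2A R) (i : Fin 6) : (-x) i = -(x i) := rfl
@[simp] lemma zero_apply (i : Fin 6) : (0 : JW2A R) i = 0 := rfl
@[simp] lemma smul_apply (S : Type) [Semiring S] [Module S R] (c : S) (x : JW2A R) (i : Fin 6) :
    (c • x) i = c • (x i) := rfl

variable (R)

def even (S : Type) [Semiring S] [Module S R] : Submodule S (JW2A R) := stdSub S R 6 {0, 3}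
def odd (S : Type) [Semiring S] [Module S R] : Submodule S (JW2A R) := stdSub S R 6 {1, 2, 4, 5}

/-- The element `(1, 0)`. -/
def oneLeft : JW2A R := ![1, 0, 0, 0, 0, 0]
/-- The element `(0, 1)`. -/
def oneRight : JW2A R := ![0, 0, 0, 1, 0, 0]
def oddE (w w' : Fin 2 → R) : JW2A R := ![0, w 0, w 1, 0, w' 0, w' 1]
def swapFun (x : JW2A R) : JW2A R := fun i =>
  match i with
  | ⟨0, _⟩ => x 3
  | ⟨1, _⟩ => x 4
  | ⟨2, _⟩ => x 5
  | ⟨3, _⟩ => x 0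
  | ⟨4, _⟩ => x 1
  | ⟨5, _⟩ => x 2

end JW2A

/-- Kac's superalgebra `K₁₀ ⊗ R`.  CoordinatesL `0 ↦ 1`, `1 ↦ a⊗a`,
`2 ↦ u⊗u`, `3 ↦ u⊗v`, `4 ↦ v⊗u`, `5 ↦ v⊗v`, `6 ↦ u⊗a`, `7 ↦ v⊗a`,
`8 ↦ a⊗u`, `9 ↦ a⊗v`. -/
def K10A (F : Type) [Field F] (R : Type) [CommRing R] [Algebra F R] : Type := Fin 10 → R

instance : AddCommGroup (K10A F R) := Pi.addCommGroup
instance (S : Type) [Semiring S] [Module S R] : Module S (K10A F R) := Pi.module _ _ _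

namespace K10A
variable {F R}

def mulFun (x y : K10A F R) : K10A F R := fun i =>
  match i with
  | ⟨0, _⟩ => x 0 * y 0 - algebraMap F R (3/16) * (x 1 * y 1)
      + algebraMap F R (3/4) * (x 2 * y 5 + x 5 * y 2 - x 3 * y 4 - x 4 * y 3)
      - algebraMap F R (3/8) * (x 6 * y 7 - x 7 * y 6 + x 8 * y 9 - x 9 * y 8)
  | ⟨1, _⟩ => x 0 * y 1 + x 1 * y 0 + x 1 * y 1
      - (x 2 * y 5 + x 5 * y 2 - x 3 * y 4 - x 4 * y 3)
      + (x 6 * y 7 - x 7 * y 6) + (x 8 * y 9 - x 9 * y 8)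
  | ⟨2, _⟩ => x 0 * y 2 + x 2 * y 0 + algebraMap F R 4⁻¹ * (x 1 * y 2 + x 2 * y 1)
      + algebraMap F R 4⁻¹ * (x 6 * y 8 - x 8 * y 6)
  | ⟨3, _⟩ => x 0 * y 3 + x 3 * y 0 + algebraMap F R 4⁻¹ * (x 1 * y 3 + x 3 * y 1)
      + algebraMap F R 4⁻¹ * (x 6 * y 9 - x 9 * y 6)
  | ⟨4, _⟩ => x 0 * y 4 + x 4 * y 0 + algebraMap F R 4⁻¹ * (x 1 * y 4 + x 4 * y 1)
      + algebraMap F R 4⁻¹ * (x 7 * y 8 - x 8 * y 7)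
  | ⟨5, _⟩ => x 0 * y 5 + x 5 * y 0 + algebraMap F R 4⁻¹ * (x 1 * y 5 + x 5 * y 1)
      + algebraMap F R 4⁻¹ * (x 7 * y 9 - x 9 * y 7)
  | ⟨6, _⟩ => x 0 * y 6 + x 6 * y 0 + algebraMap F R 2⁻¹ * (x 1 * y 6 + x 6 * y 1)
      + algebraMap F R 2⁻¹ * (x 2 * y 9 + x 9 * y 2) - algebraMap F R 2⁻¹ * (x 3 * y 8 + x 8 * y 3)
  | ⟨7, _⟩ => x 0 * y 7 + x 7 * y 0 + algebraMap F R 2⁻¹ * (x 1 * y 7 + x 7 * y 1)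
      + algebraMap F R 2⁻¹ * (x 4 * y 9 + x 9 * y 4) - algebraMap F R 2⁻¹ * (x 5 * y 8 + x 8 * y 5)
  | ⟨8, _⟩ => x 0 * y 8 + x 8 * y 0 + algebraMap F R 2⁻¹ * (x 1 * y 8 + x 8 * y 1)
      - algebraMap F R 2⁻¹ * (x 2 * y 7 + x 7 * y 2) + algebraMap F R 2⁻¹ * (x 4 * y 6 + x 6 * y 4)
  | ⟨9, _⟩ => x 0 * y 9 + x 9 * y 0 + algebraMap F R 2⁻¹ * (x 1 * y 9 + x 9 * y 1)
      - algebraMap F R 2⁻¹ * (x 3 * y 7 + x 7 * y 3) + algebraMap F R 2⁻¹ * (x 5 * y 6 + x 6 * y 5)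

instance : Mul (K10A F R) := ⟨mulFun⟩

lemma mul_def (x y : K10A F R) : x * y = mulFun x y := rfl

@[simp] lemma add_apply (x y : K10A F R) (i : Fin 10) : (x + y) i = x i + y i := rfl
@[simp] lemma sub_apply (x y : K10A F R) (i : Fin 10) : (x - y) i = x i - y i := rfl
@[simp] lemma neg_apply (x : K10A F R) (i : Fin 10) : (-x) i = -(x i) := rfl
@[simp] lemma zero_apply (i : Fin 10) : (0 : K10A F R) i = 0 := rfl
@[simp] lemma smul_apply (S : Type) [Semiring S] [Module S R] (c : S) (x : K10A F R) (i : Fin 10) :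
    (c • x) i = c • (x i) := rfl

variable (F R)

def even (S : Type) [Semiring S] [Module S R] : Submodule S (K10A F R) :=
  stdSub S R 10 {0, 1, 2, 3, 4, 5}
def odd (S : Type) [Semiring S] [Module S R] : Submodule S (K10A F R) :=
  stdSub S R 10 {6, 7, 8, 9}

/-- The unity `1`. -/
def oneE : K10A F R := ![1, 0, 0, 0, 0, 0, 0, 0, 0, 0]
/-- The element `a ⊗ a`. -/
def aaE : K10A F R := ![0, 1, 0, 0, 0, 0, 0, 0, 0, 0]
/-- The element `v ⊗ w ∈ W ⊗ W`. -/
def wwE (w w' : Fin 2 → R) : K10A F R :=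
  ![0, 0, w 0 * w' 0, w 0 * w' 1, w 1 * w' 0, w 1 * w' 1, 0, 0, 0, 0]
/-- The element `w ⊗ a`, `w ∈ W ⊗ R`. -/
def waE (w : Fin 2 → R) : K10A F R := ![0, 0, 0, 0, 0, 0, w 0, w 1, 0, 0]
/-- The element `a ⊗ w`, `w ∈ W ⊗ R`. -/
def awE (w : Fin 2 → R) : K10A F R := ![0, 0, 0, 0, 0, 0, 0, 0, w 0, w 1]
/-- The exchange automorphism `τ`, `τ(x ⊗ y) = (-1)^{|x||y|} y ⊗ x`. -/
def tauFun (x : K10A F R) : K10A F R := fun i =>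
  match i with
  | ⟨0, _⟩ => x 0
  | ⟨1, _⟩ => x 1
  | ⟨2, _⟩ => -x 2
  | ⟨3, _⟩ => -x 4
  | ⟨4, _⟩ => -x 3
  | ⟨5, _⟩ => -x 5
  | ⟨6, _⟩ => x 8
  | ⟨7, _⟩ => x 9
  | ⟨8, _⟩ => x 6
  | ⟨9, _⟩ => x 7

end K10A

end Algebras

end Kac

namespace Kac

section GradingDefs

variable (F : Type) [Field F] {G : Type} [CommGroup G]

/-- Standard basis of `K₃ × K₃` (`a₁, u₁, v₁, a₂, u₂, v₂`). -/
def K33A.bv (i : Fin 6) : K33A F F := Pi.single i 1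

/-- The grading `Γ¹(G; g₁, g₂)` on `K₃ × K₃`: all even elements have degree
`e`, `deg (u,0) = g₁ = deg (v,0)⁻¹`, `deg (0,u) = g₂ = deg (0,v)⁻¹`. -/
def K33A.gamma1 (g1 g2 : G) : G → Submodule F (K33A F F) :=
  gradingOf F (K33A.bv F) ![1, g1, g1⁻¹, 1, g2, g2⁻¹]

/-- The grading `Γ²(G; g, h)` on `K₃ × K₃` (`h² = e ≠ h`):
`deg (a,a) = e`, `deg (a,-a) = h`, `deg (u,u) = g = deg (v,v)⁻¹`,
`deg (u,-u) = gh = deg (v,-v)⁻¹`. -/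
def K33A.gamma2 (g h : G) : G → Submodule F (K33A F F) :=
  gradingOf F
    ![K33A.bv F 0 + K33A.bv F 3, K33A.bv F 0 - K33A.bv F 3,
      K33A.bv F 1 + K33A.bv F 4, K33A.bv F 2 + K33A.bv F 5,
      K33A.bv F 1 - K33A.bv F 4, K33A.bv F 2 - K33A.bv F 5]
    ![1, h, g, g⁻¹, g * h, g⁻¹ * h]

/-- Standard (homogeneous) basis of `K₁₀`:
`1, a⊗a, u⊗u, u⊗v, v⊗u, v⊗v, u⊗a, v⊗a, a⊗u, a⊗v`. -/
def K10A.bv (i : Fin 10) : K10A F F := Pi.single i 1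

/-- The grading `Γ¹_{K₁₀}(G; g₁, g₂)` on `K₁₀`, determined by
`deg (u⊗a) = g₁ = deg (v⊗a)⁻¹`, `deg (a⊗u) = g₂ = deg (a⊗v)⁻¹`. -/
def K10A.gamma1 (g1 g2 : G) : G → Submodule F (K10A F F) :=
  gradingOf F (K10A.bv F)
    ![1, 1, g1 * g2, g1 * g2⁻¹, g1⁻¹ * g2, g1⁻¹ * g2⁻¹, g1, g1⁻¹, g2, g2⁻¹]

/-- The grading `Γ²_{K₁₀}(G; g, h)` on `K₁₀` (`h² = e ≠ h`), determined by
`deg (u⊗a + a⊗u) = g = deg (v⊗a + a⊗v)⁻¹`,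
`deg (u⊗a - a⊗u) = gh = deg (v⊗a - a⊗v)⁻¹`. -/
def K10A.gamma2 (g h : G) : G → Submodule F (K10A F F) :=
  gradingOf F
    ![K10A.bv F 0, K10A.bv F 1, K10A.bv F 3 - K10A.bv F 4,
      K10A.bv F 3 + K10A.bv F 4, K10A.bv F 2, K10A.bv F 5,
      K10A.bv F 6 + K10A.bv F 8, K10A.bv F 7 + K10A.bv F 9,
      K10A.bv F 6 - K10A.bv F 8, K10A.bv F 7 - K10A.bv F 9]
    ![1, 1, 1, h, g * g * h, g⁻¹ * g⁻¹ * h, g, g⁻¹, g * h, g⁻¹ * h]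

end GradingDefs

end Kac

namespace Kac

namespace K10A

section Coordinates

variable {F : Type} [Field F]

lemma ext_coord {x y : K10A F F} (h0 : x 0 = y 0) (h1 : x 1 = y 1) (h2 : x 2 = y 2)
    (h3 : x 3 = y 3) (h4 : x 4 = y 4) (h5 : x 5 = y 5) (h6 : x 6 = y 6) (h7 : x 7 = y 7)
    (h8 : x 8 = y 8) (h9 : x 9 = y 9) : x = y := by
  funext i
  fin_cases i <;> assumption

lemma three_div_sixteen : (3 / 16 : F) = 3 * (2⁻¹) ^ 4 := by
  rw [inv_pow, div_eq_mul_inv]; norm_num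

lemma three_div_eight : (3 / 8 : F) = 3 * (2⁻¹) ^ 3 := by
  rw [inv_pow, div_eq_mul_inv]; norm_num

lemma three_div_four : (3 / 4 : F) = 3 * (2⁻¹) ^ 2 := by
  rw [inv_pow, div_eq_mul_inv]; norm_num

lemma four_inv : (4⁻¹ : F) = (2⁻¹) ^ 2 := by
  rw [inv_pow]; norm_num

variable (x y : K10A F F)

lemma mul_apply_zero : (x * y) 0 = x 0 * y 0 - 3 * (2⁻¹) ^ 4 * (x 1 * y 1)
      + 3 * (2⁻¹) ^ 2 * (x 2 * y 5 + x 5 * y 2 - x 3 * y 4 - x 4 * y 3)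
      - 3 * (2⁻¹) ^ 3 * (x 6 * y 7 - x 7 * y 6 + x 8 * y 9 - x 9 * y 8) := by
  rw [← three_div_sixteen, ← three_div_eight, ← three_div_four]; rfl

lemma mul_apply_one : (x * y) 1 = x 0 * y 1 + x 1 * y 0 + x 1 * y 1
      - (x 2 * y 5 + x 5 * y 2 - x 3 * y 4 - x 4 * y 3)
      + (x 6 * y 7 - x 7 * y 6) + (x 8 * y 9 - x 9 * y 8) := rfl

lemma mul_apply_two : (x * y) 2 = x 0 * y 2 + x 2 * y 0
      + (2⁻¹) ^ 2 * (x 1 * y 2 + x 2 * y 1) + (2⁻¹) ^ 2 * (x 6 * y 8 - x 8 * y 6) := by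
  rw [← four_inv]; rfl

lemma mul_apply_three : (x * y) 3 = x 0 * y 3 + x 3 * y 0
      + (2⁻¹) ^ 2 * (x 1 * y 3 + x 3 * y 1) + (2⁻¹) ^ 2 * (x 6 * y 9 - x 9 * y 6) := by
  rw [← four_inv]; rfl

lemma mul_apply_four : (x * y) 4 = x 0 * y 4 + x 4 * y 0
      + (2⁻¹) ^ 2 * (x 1 * y 4 + x 4 * y 1) + (2⁻¹) ^ 2 * (x 7 * y 8 - x 8 * y 7) := by
  rw [← four_inv]; rfl

lemma mul_apply_five : (x * y) 5 = x 0 * y 5 + x 5 * y 0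
      + (2⁻¹) ^ 2 * (x 1 * y 5 + x 5 * y 1) + (2⁻¹) ^ 2 * (x 7 * y 9 - x 9 * y 7) := by
  rw [← four_inv]; rfl

lemma mul_apply_six : (x * y) 6 = x 0 * y 6 + x 6 * y 0 + 2⁻¹ * (x 1 * y 6 + x 6 * y 1)
      + 2⁻¹ * (x 2 * y 9 + x 9 * y 2) - 2⁻¹ * (x 3 * y 8 + x 8 * y 3) := rfl

lemma mul_apply_seven : (x * y) 7 = x 0 * y 7 + x 7 * y 0 + 2⁻¹ * (x 1 * y 7 + x 7 * y 1)
      + 2⁻¹ * (x 4 * y 9 + x 9 * y 4) - 2⁻¹ * (x 5 * y 8 + x 8 * y 5) := rfl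

lemma mul_apply_eight : (x * y) 8 = x 0 * y 8 + x 8 * y 0 + 2⁻¹ * (x 1 * y 8 + x 8 * y 1)
      - 2⁻¹ * (x 2 * y 7 + x 7 * y 2) + 2⁻¹ * (x 4 * y 6 + x 6 * y 4) := rfl

lemma mul_apply_nine : (x * y) 9 = x 0 * y 9 + x 9 * y 0 + 2⁻¹ * (x 1 * y 9 + x 9 * y 1)
      - 2⁻¹ * (x 3 * y 7 + x 7 * y 3) + 2⁻¹ * (x 5 * y 6 + x 6 * y 5) := rfl

end Coordinates

section Bilinear

variable {F : Type} [Field F] (x y z : K10A F F)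

protected lemma add_mul : (x + y) * z = x * z + y * z := by
  apply ext_coord <;> simp only [mul_apply_zero, mul_apply_one, mul_apply_two, mul_apply_three,
    mul_apply_four, mul_apply_five, mul_apply_six, mul_apply_seven, mul_apply_eight,
    mul_apply_nine, add_apply] <;> ring

protected lemma mul_add : z * (x + y) = z * x + z * y := by
  apply ext_coord <;> simp only [mul_apply_zero, mul_apply_one, mul_apply_two, mul_apply_three,
    mul_apply_four, mul_apply_five, mul_apply_six, mul_apply_seven, mul_apply_eight,
    mul_apply_nine, add_apply] <;> ring

protected lemma smul_mul (c : F) : (c • x) * y = c • (x * y) := by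
  apply ext_coord <;> simp only [mul_apply_zero, mul_apply_one, mul_apply_two, mul_apply_three,
    mul_apply_four, mul_apply_five, mul_apply_six, mul_apply_seven, mul_apply_eight,
    mul_apply_nine, smul_apply, smul_eq_mul] <;> ring

protected lemma mul_smul (c : F) : x * (c • y) = c • (x * y) := by
  apply ext_coord <;> simp only [mul_apply_zero, mul_apply_one, mul_apply_two, mul_apply_three,
    mul_apply_four, mul_apply_five, mul_apply_six, mul_apply_seven, mul_apply_eight,
    mul_apply_nine, smul_apply, smul_eq_mul] <;> ring

variable (F) in
/-- The product of `K₁₀` as a bilinear map. -/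
def mulBilin : K10A F F →ₗ[F] K10A F F →ₗ[F] K10A F F :=
  LinearMap.mk₂ F (· * ·) K10A.add_mul (fun c x y => K10A.smul_mul x y c)
    (fun z x y => K10A.mul_add x y z) (fun c x y => K10A.mul_smul x y c)

@[simp] lemma mulBilin_apply : mulBilin F x y = x * y := rfl

lemma bv_apply (i j : Fin 10) : K10A.bv F i j = if j = i then 1 else 0 := by
  unfold K10A.bv
  exact Pi.single_apply i 1 j

protected lemma one_mul : K10A.bv F 0 * x = x := by
  apply ext_coord <;> simp [mul_apply_zero, mul_apply_one, mul_apply_two, mul_apply_three,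
    mul_apply_four, mul_apply_five, mul_apply_six, mul_apply_seven, mul_apply_eight,
    mul_apply_nine, bv_apply]

protected lemma mul_one : x * K10A.bv F 0 = x := by
  apply ext_coord <;> simp [mul_apply_zero, mul_apply_one, mul_apply_two, mul_apply_three,
    mul_apply_four, mul_apply_five, mul_apply_six, mul_apply_seven, mul_apply_eight,
    mul_apply_nine, bv_apply]

lemma mem_even_iff : x ∈ K10A.even F F F ↔
    x 6 = 0 ∧ x 7 = 0 ∧ x 8 = 0 ∧ x 9 = 0 := by
  constructor
  · intro h
    exact ⟨h 6 (by decide), h 7 (by decide), h 8 (by decide), h 9 (by decide)⟩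
  · rintro ⟨h6, h7, h8, h9⟩ i hi
    fin_cases i <;> first | assumption | exact absurd (by simp) hi

lemma mem_odd_iff : x ∈ K10A.odd F F F ↔
    x 0 = 0 ∧ x 1 = 0 ∧ x 2 = 0 ∧ x 3 = 0 ∧ x 4 = 0 ∧ x 5 = 0 := by
  constructor
  · intro h
    exact ⟨h 0 (by decide), h 1 (by decide), h 2 (by decide), h 3 (by decide),
      h 4 (by decide), h 5 (by decide)⟩
  · rintro ⟨h0, h1, h2, h3, h4, h5⟩ i hi
    fin_cases i <;> first | assumption | exact absurd (by simp) hi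

end Bilinear

section Triple

variable {F : Type} [Field F]

variable (F) in
/-- The projection of `K₁₀` onto `W ⊗ a`. -/
def projLeft : K10A F F →ₗ[F] K10A F F where
  toFun x := x 6 • K10A.bv F 6 + x 7 • K10A.bv F 7
  map_add' x y := by rw [add_apply, add_apply]; module
  map_smul' c x := by simp only [smul_apply, smul_eq_mul, RingHom.id_apply]; module

variable (F) in
/-- The projection of `K₁₀` onto `a ⊗ W`. -/
def projRight : K10A F F →ₗ[F] K10A F F where
  toFun x := x 8 • K10A.bv F 8 + x 9 • K10A.bv F 9
  map_add' x y := by rw [add_apply, add_apply]; module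
  map_smul' c x := by simp only [smul_apply, smul_eq_mul, RingHom.id_apply]; module

lemma projLeft_apply (x : K10A F F) : projLeft F x = x 6 • K10A.bv F 6 + x 7 • K10A.bv F 7 := rfl

lemma projRight_apply (x : K10A F F) :
    projRight F x = x 8 • K10A.bv F 8 + x 9 • K10A.bv F 9 := rfl

/-- The symplectic form on `W ⊗ a`, extended by zero. -/
def omegaLeft (x y : K10A F F) : F := x 6 * y 7 - x 7 * y 6

/-- The symplectic form on `a ⊗ W`, extended by zero. -/
def omegaRight (x y : K10A F F) : F := x 8 * y 9 - x 9 * y 8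

lemma mem_odd_iff_proj (x : K10A F F) : x ∈ K10A.odd F F F ↔ projLeft F x + projRight F x = x := by
  rw [mem_odd_iff]
  constructor
  · rintro ⟨h0, h1, h2, h3, h4, h5⟩
    apply ext_coord <;> simp [projLeft_apply, projRight_apply, bv_apply, *]
  · intro h
    rw [← h]
    simp [projLeft_apply, projRight_apply, bv_apply]

lemma projLeft_mem_odd (x : K10A F F) : projLeft F x ∈ K10A.odd F F F := by
  rw [mem_odd_iff]; simp [projLeft_apply, bv_apply]

lemma projRight_mem_odd (x : K10A F F) : projRight F x ∈ K10A.odd F F F := by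
  rw [mem_odd_iff]; simp [projRight_apply, bv_apply]

/-- The triple product of the odd part of `K₁₀`. -/
lemma odd_triple (hchar : (2 : F) ≠ 0) {x y z : K10A F F} (hx : x ∈ K10A.odd F F F)
    (hy : y ∈ K10A.odd F F F) (hz : z ∈ K10A.odd F F F) :
    (8 : F) • ((x * y) * z) = (omegaLeft x y + omegaRight x y) • z
      + (omegaRight y z • projLeft F x - omegaRight x z • projLeft F y)
      + (omegaLeft y z • projRight F x - omegaLeft x z • projRight F y) := by
  rw [mem_odd_iff] at hx hy hz
  obtain ⟨hx0, hx1, hx2, hx3, hx4, hx5⟩ := hx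
  obtain ⟨hy0, hy1, hy2, hy3, hy4, hy5⟩ := hy
  obtain ⟨hz0, hz1, hz2, hz3, hz4, hz5⟩ := hz
  have ht : 2 * (2⁻¹ : F) = 1 := mul_inv_cancel₀ hchar
  generalize hh : (2⁻¹ : F) = t at ht
  apply ext_coord <;> simp only [mul_apply_zero, mul_apply_one, mul_apply_two, mul_apply_three,
    mul_apply_four, mul_apply_five, mul_apply_six, mul_apply_seven, mul_apply_eight,
    mul_apply_nine, add_apply, sub_apply, smul_apply, smul_eq_mul, projLeft_apply, projRight_apply,
    omegaLeft, omegaRight, hx0, hx1, hx2, hx3, hx4, hx5, hy0, hy1, hy2, hy3, hy4, hy5,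
    hz0, hz1, hz2, hz3, hz4, hz5, hh, bv_apply] <;> simp <;> grind

end Triple

end K10A

end Kac

namespace Kac

namespace K10A

section Symplectic

variable {F : Type} [Field F]

/-- The underlying function of `symp`. -/
def sympFun (m n x : K10A F F) : K10A F F := fun i =>
  match i with
  | ⟨0, _⟩ => x 0
  | ⟨1, _⟩ => x 1
  | ⟨2, _⟩ => m 6 * m 8 * x 2 + m 6 * n 8 * x 3 + n 6 * m 8 * x 4 + n 6 * n 8 * x 5
  | ⟨3, _⟩ => m 6 * m 9 * x 2 + m 6 * n 9 * x 3 + n 6 * m 9 * x 4 + n 6 * n 9 * x 5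
  | ⟨4, _⟩ => m 7 * m 8 * x 2 + m 7 * n 8 * x 3 + n 7 * m 8 * x 4 + n 7 * n 8 * x 5
  | ⟨5, _⟩ => m 7 * m 9 * x 2 + m 7 * n 9 * x 3 + n 7 * m 9 * x 4 + n 7 * n 9 * x 5
  | ⟨6, _⟩ => m 6 * x 6 + n 6 * x 7
  | ⟨7, _⟩ => m 7 * x 6 + n 7 * x 7
  | ⟨8, _⟩ => m 8 * x 8 + n 8 * x 9
  | ⟨9, _⟩ => m 9 * x 8 + n 9 * x 9

/-- The linear endomorphism of `K₁₀` induced by the endomorphisms of the two copies of `W` that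
send `u` and `v` to the components of `m` and of `n`, respectively. -/
def symp (m n : K10A F F) : K10A F F →ₗ[F] K10A F F where
  toFun := sympFun m n
  map_add' x y := by
    apply ext_coord <;> simp only [add_apply] <;> simp only [sympFun, add_apply] <;> ring
  map_smul' c x := by
    apply ext_coord <;> simp only [smul_apply] <;>
      simp only [sympFun, smul_apply, smul_eq_mul, RingHom.id_apply] <;> ring

variable (m n x : K10A F F)

lemma symp_apply_zero : symp m n x 0 = x 0 := rfl
lemma symp_apply_one : symp m n x 1 = x 1 := rfl
lemma symp_apply_two : symp m n x 2 =
    m 6 * m 8 * x 2 + m 6 * n 8 * x 3 + n 6 * m 8 * x 4 + n 6 * n 8 * x 5 := rfl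
lemma symp_apply_three : symp m n x 3 =
    m 6 * m 9 * x 2 + m 6 * n 9 * x 3 + n 6 * m 9 * x 4 + n 6 * n 9 * x 5 := rfl
lemma symp_apply_four : symp m n x 4 =
    m 7 * m 8 * x 2 + m 7 * n 8 * x 3 + n 7 * m 8 * x 4 + n 7 * n 8 * x 5 := rfl
lemma symp_apply_five : symp m n x 5 =
    m 7 * m 9 * x 2 + m 7 * n 9 * x 3 + n 7 * m 9 * x 4 + n 7 * n 9 * x 5 := rfl
lemma symp_apply_six : symp m n x 6 = m 6 * x 6 + n 6 * x 7 := rfl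
lemma symp_apply_seven : symp m n x 7 = m 7 * x 6 + n 7 * x 7 := rfl
lemma symp_apply_eight : symp m n x 8 = m 8 * x 8 + n 8 * x 9 := rfl
lemma symp_apply_nine : symp m n x 9 = m 9 * x 8 + n 9 * x 9 := rfl

lemma symp_even {x : K10A F F} (hx : x ∈ K10A.even F F F) : symp m n x ∈ K10A.even F F F := by
  rw [mem_even_iff] at hx ⊢
  simp [symp_apply_six, symp_apply_seven, symp_apply_eight, symp_apply_nine, hx]

lemma symp_odd {x : K10A F F} (hx : x ∈ K10A.odd F F F) : symp m n x ∈ K10A.odd F F F := by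
  rw [mem_odd_iff] at hx ⊢
  simp [symp_apply_zero, symp_apply_one, symp_apply_two, symp_apply_three, symp_apply_four,
    symp_apply_five, hx]

variable {m n}

lemma symp_mul (hl : omegaLeft m n = 1) (hr : omegaRight m n = 1) (x y : K10A F F) :
    symp m n (x * y) = symp m n x * symp m n y := by
  unfold omegaLeft at hl
  unfold omegaRight at hr
  apply ext_coord <;> simp only [mul_apply_zero, mul_apply_one, mul_apply_two, mul_apply_three,
    mul_apply_four, mul_apply_five, mul_apply_six, mul_apply_seven, mul_apply_eight,
    mul_apply_nine, symp_apply_zero, symp_apply_one, symp_apply_two, symp_apply_three,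
    symp_apply_four, symp_apply_five, symp_apply_six, symp_apply_seven, symp_apply_eight,
    symp_apply_nine] <;> generalize (2⁻¹ : F) = t
  · linear_combination
      (-3 * t ^ 2 * (x 2 * y 5 + x 5 * y 2 - x 3 * y 4 - x 4 * y 3) * (m 8 * n 9 - m 9 * n 8)
        + 3 * t ^ 3 * (x 6 * y 7 - x 7 * y 6)) * hl
      + (-3 * t ^ 2 * (x 2 * y 5 + x 5 * y 2 - x 3 * y 4 - x 4 * y 3)
        + 3 * t ^ 3 * (x 8 * y 9 - x 9 * y 8)) * hr
  · linear_combination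
      ((x 2 * y 5 + x 5 * y 2 - x 3 * y 4 - x 4 * y 3) * (m 8 * n 9 - m 9 * n 8)
        - (x 6 * y 7 - x 7 * y 6)) * hl
      + ((x 2 * y 5 + x 5 * y 2 - x 3 * y 4 - x 4 * y 3) - (x 8 * y 9 - x 9 * y 8)) * hr
  · ring
  · ring
  · ring
  · ring
  · linear_combination
      (-t * (m 6 * (x 2 * y 9 + x 9 * y 2 - (x 3 * y 8 + x 8 * y 3))
        + n 6 * (x 4 * y 9 + x 9 * y 4 - (x 5 * y 8 + x 8 * y 5)))) * hr
  · linear_combination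
      (-t * (m 7 * (x 2 * y 9 + x 9 * y 2 - (x 3 * y 8 + x 8 * y 3))
        + n 7 * (x 4 * y 9 + x 9 * y 4 - (x 5 * y 8 + x 8 * y 5)))) * hr
  · linear_combination
      (-t * (m 8 * (x 4 * y 6 + x 6 * y 4 - (x 2 * y 7 + x 7 * y 2))
        + n 8 * (x 5 * y 6 + x 6 * y 5 - (x 3 * y 7 + x 7 * y 3)))) * hl
  · linear_combination
      (-t * (m 9 * (x 4 * y 6 + x 6 * y 4 - (x 2 * y 7 + x 7 * y 2))
        + n 9 * (x 5 * y 6 + x 6 * y 5 - (x 3 * y 7 + x 7 * y 3)))) * hl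

/-- The first of the two elements defining the inverse of `symp m n`. -/
def sympInvFst (m n : K10A F F) : K10A F F :=
  n 7 • K10A.bv F 6 - m 7 • K10A.bv F 7 + n 9 • K10A.bv F 8 - m 9 • K10A.bv F 9

/-- The second of the two elements defining the inverse of `symp m n`. -/
def sympInvSnd (m n : K10A F F) : K10A F F :=
  -n 6 • K10A.bv F 6 + m 6 • K10A.bv F 7 - n 8 • K10A.bv F 8 + m 8 • K10A.bv F 9

lemma symp_sympInv (hl : omegaLeft m n = 1) (hr : omegaRight m n = 1) (x : K10A F F) :
    symp m n (symp (sympInvFst m n) (sympInvSnd m n) x) = x := by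
  unfold omegaLeft at hl
  unfold omegaRight at hr
  apply ext_coord <;> simp only [symp_apply_zero, symp_apply_one, symp_apply_two, symp_apply_three,
    symp_apply_four, symp_apply_five, symp_apply_six, symp_apply_seven, symp_apply_eight,
    symp_apply_nine, sympInvFst, sympInvSnd, add_apply, sub_apply, smul_apply, smul_eq_mul,
    bv_apply] <;> simp
  · linear_combination (m 8 * n 9 - m 9 * n 8) * x 2 * hl + x 2 * hr
  · linear_combination (m 8 * n 9 - m 9 * n 8) * x 3 * hl + x 3 * hr
  · linear_combination (m 8 * n 9 - m 9 * n 8) * x 4 * hl + x 4 * hr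
  · linear_combination (m 8 * n 9 - m 9 * n 8) * x 5 * hl + x 5 * hr
  · linear_combination x 6 * hl
  · linear_combination x 7 * hl
  · linear_combination x 8 * hr
  · linear_combination x 9 * hr

lemma sympInv_symp (hl : omegaLeft m n = 1) (hr : omegaRight m n = 1) (x : K10A F F) :
    symp (sympInvFst m n) (sympInvSnd m n) (symp m n x) = x := by
  unfold omegaLeft at hl
  unfold omegaRight at hr
  apply ext_coord <;> simp only [symp_apply_zero, symp_apply_one, symp_apply_two, symp_apply_three,
    symp_apply_four, symp_apply_five, symp_apply_six, symp_apply_seven, symp_apply_eight,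
    symp_apply_nine, sympInvFst, sympInvSnd, add_apply, sub_apply, smul_apply, smul_eq_mul,
    bv_apply] <;> simp
  · linear_combination (m 8 * n 9 - m 9 * n 8) * x 2 * hl + x 2 * hr
  · linear_combination (m 8 * n 9 - m 9 * n 8) * x 3 * hl + x 3 * hr
  · linear_combination (m 8 * n 9 - m 9 * n 8) * x 4 * hl + x 4 * hr
  · linear_combination (m 8 * n 9 - m 9 * n 8) * x 5 * hl + x 5 * hr
  · linear_combination x 6 * hl
  · linear_combination x 7 * hl
  · linear_combination x 8 * hr
  · linear_combination x 9 * hr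

/-- The automorphism of `K₁₀` given by a pair of symplectic bases of the two copies of `W`. -/
def sympAut (m n : K10A F F) (hl : omegaLeft m n = 1) (hr : omegaRight m n = 1) :
    SuperAut F (K10A F F) (K10A.even F F F) (K10A.odd F F F) where
  e := LinearEquiv.ofLinearMap (symp m n) (symp (sympInvFst m n) (sympInvSnd m n))
    (LinearMap.ext (symp_sympInv hl hr)) (LinearMap.ext (sympInv_symp hl hr))
  map_mul' := symp_mul hl hr
  map_even := by
    apply le_antisymm
    · rintro _ ⟨x, hx, rfl⟩
      exact symp_even m n hx
    · intro x hx
      exact ⟨_, symp_even _ _ hx, symp_sympInv hl hr x⟩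
  map_odd := by
    apply le_antisymm
    · rintro _ ⟨x, hx, rfl⟩
      exact symp_odd m n hx
    · intro x hx
      exact ⟨_, symp_odd _ _ hx, symp_sympInv hl hr x⟩

variable (hl : omegaLeft m n = 1) (hr : omegaRight m n = 1)

lemma sympAut_bv_six : (sympAut m n hl hr).e (K10A.bv F 6) = projLeft F m := by
  change symp m n _ = _
  apply ext_coord <;> simp only [symp_apply_zero, symp_apply_one, symp_apply_two, symp_apply_three,
    symp_apply_four, symp_apply_five, symp_apply_six, symp_apply_seven, symp_apply_eight,
    symp_apply_nine, bv_apply, projLeft_apply, add_apply, smul_apply] <;> simp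

lemma sympAut_bv_seven : (sympAut m n hl hr).e (K10A.bv F 7) = projLeft F n := by
  change symp m n _ = _
  apply ext_coord <;> simp only [symp_apply_zero, symp_apply_one, symp_apply_two, symp_apply_three,
    symp_apply_four, symp_apply_five, symp_apply_six, symp_apply_seven, symp_apply_eight,
    symp_apply_nine, bv_apply, projLeft_apply, add_apply, smul_apply] <;> simp

lemma sympAut_bv_eight : (sympAut m n hl hr).e (K10A.bv F 8) = projRight F m := by
  change symp m n _ = _
  apply ext_coord <;> simp only [symp_apply_zero, symp_apply_one, symp_apply_two, symp_apply_three,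
    symp_apply_four, symp_apply_five, symp_apply_six, symp_apply_seven, symp_apply_eight,
    symp_apply_nine, bv_apply, projRight_apply, add_apply, smul_apply] <;> simp

lemma sympAut_bv_nine : (sympAut m n hl hr).e (K10A.bv F 9) = projRight F n := by
  change symp m n _ = _
  apply ext_coord <;> simp only [symp_apply_zero, symp_apply_one, symp_apply_two, symp_apply_three,
    symp_apply_four, symp_apply_five, symp_apply_six, symp_apply_seven, symp_apply_eight,
    symp_apply_nine, bv_apply, projRight_apply, add_apply, smul_apply] <;> simp

end Symplectic

end K10A

end Kac

namespace Kac

section GradingOf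

variable {F A G : Type} [Field F] [AddCommGroup A] [Module F A] [CommGroup G]
  {n : ℕ} {w : Fin n → A} {d : Fin n → G}

lemma mem_gradingOf (i : Fin n) : w i ∈ gradingOf F w d (d i) :=
  Submodule.subset_span ⟨i, rfl, rfl⟩

lemma gradingOf_le {g : G} {p : Submodule F A} (h : ∀ i, d i = g → w i ∈ p) :
    gradingOf F w d g ≤ p := by
  refine Submodule.span_le.2 ?_
  rintro _ ⟨i, hi, rfl⟩
  exact h i hi

lemma gradingOf_ne_bot_iff (hw : LinearIndependent F w) {g : G} :
    gradingOf F w d g ≠ ⊥ ↔ g ∈ Set.range d := by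
  constructor
  · intro h
    by_contra hg
    exact h (eq_bot_iff.2 (gradingOf_le fun i hi => absurd ⟨i, hi⟩ hg))
  · rintro ⟨i, rfl⟩ h
    have := mem_gradingOf (F := F) (w := w) (d := d) i
    rw [h, Submodule.mem_bot] at this
    exact hw.ne_zero i this

end GradingOf

section GradingLemmas

variable {F A G H : Type} [Field F] [AddCommGroup A] [Module F A] [Mul A]
  [CommGroup G] [CommGroup H] {ev od : Submodule F A}
  {Γ : G → Submodule F A} {Δ : H → Submodule F A}

lemma isSuperGrading_iff : IsSuperGrading ev od Γ ↔
    (iSupIndep Γ ∧ iSup Γ = ⊤) ∧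
    (∀ (g h : G) (x y : A), x ∈ Γ g → y ∈ Γ h → x * y ∈ Γ (g * h)) ∧
    (∀ g, Γ g = (Γ g ⊓ ev) ⊔ (Γ g ⊓ od)) := by
  classical
  unfold IsSuperGrading
  rw [DirectSum.isInternal_submodule_iff_iSupIndep_and_iSup_eq_top]

namespace IsSuperGrading

lemma indep (hΓ : IsSuperGrading ev od Γ) : iSupIndep Γ := (isSuperGrading_iff.1 hΓ).1.1

lemma iSup_eq_top (hΓ : IsSuperGrading ev od Γ) : iSup Γ = ⊤ := (isSuperGrading_iff.1 hΓ).1.2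

lemma mul_mem (hΓ : IsSuperGrading ev od Γ) {g h : G} {x y : A} (hx : x ∈ Γ g) (hy : y ∈ Γ h) :
    x * y ∈ Γ (g * h) := hΓ.2.1 g h x y hx hy

lemma exists_proj (hΓ : IsSuperGrading ev od Γ) : ∃ π : G → A →ₗ[F] A,
    (∀ g x, π g x ∈ Γ g) ∧ (∀ g, ∀ x ∈ Γ g, π g x = x) ∧
    (∀ g h, g ≠ h → ∀ x ∈ Γ h, π g x = 0) := by
  classical
  have hint : DirectSum.IsInternal Γ :=
    (DirectSum.isInternal_submodule_iff_iSupIndep_and_iSup_eq_top Γ).2 ⟨hΓ.indep, hΓ.iSup_eq_top⟩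
  let e := LinearEquiv.ofBijective (DirectSum.coeLinearMap Γ) hint
  have he : ∀ g (x : Γ g), e.symm (x : A) = DirectSum.lof F G (fun g => Γ g) g x := fun g x => by
    rw [LinearEquiv.symm_apply_eq]
    exact (DirectSum.coeLinearMap_lof Γ g x).symm
  refine ⟨fun g => (Γ g).subtype ∘ₗ DirectSum.component F G (fun g => Γ g) g ∘ₗ e.symm.toLinearMap,
    fun g x => Subtype.coe_prop _, fun g x hx => ?_, fun g h hne x hx => ?_⟩
  · have := he g ⟨x, hx⟩
    simp only [LinearMap.comp_apply, LinearEquiv.coe_coe] at this ⊢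
    rw [this, DirectSum.component.lof_self]
    rfl
  · have := he h ⟨x, hx⟩
    simp only [LinearMap.comp_apply, LinearEquiv.coe_coe] at this ⊢
    rw [this, DirectSum.component.of, dif_neg hne.symm]
    rfl

lemma degree_unique (hΓ : IsSuperGrading ev od Γ) {g h : G} {x : A} (hg : x ∈ Γ g)
    (hh : x ∈ Γ h) (hx : x ≠ 0) : g = h := by
  by_contra hne
  exact hx ((Submodule.disjoint_def.1 (hΓ.indep.pairwiseDisjoint hne)) x hg hh)

lemma linearMap_ext {M : Type} [AddCommGroup M] [Module F M] (hΓ : IsSuperGrading ev od Γ)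
    {f f' : A →ₗ[F] M} (h : ∀ g, ∀ x ∈ Γ g, f x = f' x) : f = f' := by
  have : (⊤ : Submodule F A) ≤ LinearMap.eqLocus f f' := by
    rw [← hΓ.iSup_eq_top]
    exact iSup_le fun g x hx => h g x hx
  exact LinearMap.ext fun x => this (Submodule.mem_top)

lemma map (hΓ : IsSuperGrading ev od Γ) (φ : SuperAut F A ev od) :
    IsSuperGrading ev od fun g => (Γ g).map φ.e.toLinearMap := by
  rw [isSuperGrading_iff]
  refine ⟨⟨?_, ?_⟩, ?_, fun g => ?_⟩
  · exact hΓ.indep.map_orderIso (Submodule.orderIsoMapComap φ.e)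
  · rw [← Submodule.map_iSup, hΓ.iSup_eq_top, Submodule.map_top]
    exact LinearEquiv.range φ.e
  · rintro g h _ _ ⟨x, hx, rfl⟩ ⟨y, hy, rfl⟩
    exact ⟨x * y, hΓ.mul_mem hx hy, φ.map_mul' x y⟩
  · conv_lhs => rw [hΓ.2.2 g]
    rw [Submodule.map_sup, Submodule.map_inf _ φ.e.injective, Submodule.map_inf _ φ.e.injective,
      φ.map_even, φ.map_odd]

lemma exists_le_of_refines (hΓ : IsSuperGrading ev od Γ) (hΔ : IsSuperGrading ev od Δ)
    (hr : Refines Δ Γ) {g : G} (hg : Γ g ≠ ⊥) : ∃ h, Δ h ≠ ⊥ ∧ Δ h ≤ Γ g := by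
  by_contra! hcon
  obtain ⟨π, -, hπ1, hπ2⟩ := hΓ.exists_proj
  have h0 : π g = 0 := hΔ.linearMap_ext fun h x hx => by
    by_cases hh : Δ h = ⊥
    · rw [hh, Submodule.mem_bot] at hx
      simp [hx]
    · obtain ⟨g', hg'⟩ := hr h hh
      rw [hπ2 g g' (by rintro rfl; exact hcon h hh hg') x (hg' hx)]
      rfl
  apply hg
  rw [eq_bot_iff]
  intro x hx
  rw [Submodule.mem_bot, ← hπ1 g x hx, h0]
  rfl

/-- Two gradings have the same nonzero components if one refines the other and splits no
component. -/
lemma components_eq (hΓ : IsSuperGrading ev od Γ) (hΔ : IsSuperGrading ev od Δ)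
    (hr : Refines Δ Γ) (h : ∀ g k, Δ k ≠ ⊥ → Δ k ≤ Γ g → Γ g ≤ Δ k) :
    {p : Submodule F A | p ≠ ⊥ ∧ ∃ k, Δ k = p} = {p : Submodule F A | p ≠ ⊥ ∧ ∃ g, Γ g = p} := by
  ext p
  constructor
  · rintro ⟨hp, k, rfl⟩
    obtain ⟨g, hg⟩ := hr k hp
    exact ⟨hp, g, le_antisymm (h g k hp hg) hg⟩
  · rintro ⟨hp, g, rfl⟩
    obtain ⟨k, hk, hkg⟩ := hΓ.exists_le_of_refines hΔ hr hp
    exact ⟨hp, k, le_antisymm hkg (h g k hk hkg)⟩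

lemma injective_of_ne_bot (hΓ : IsSuperGrading ev od Γ) {g h : G} (hg : Γ g ≠ ⊥)
    (hgh : Γ g = Γ h) : g = h := by
  obtain ⟨x, hx, hx0⟩ := Submodule.exists_mem_ne_zero_of_ne_bot hg
  exact hΓ.degree_unique hx (hgh ▸ hx) hx0

/-- If an automorphism maps a grading to a refinement of a fine grading, then the two gradings are
equivalent. -/
lemma gradEquiv_of_refines (hΓ : IsSuperGrading ev od Γ) (hΔ : IsSuperGrading ev od Δ)
    (hfine : IsFine ev od Γ) (φ : SuperAut F A ev od)
    (hr : Refines (fun h => (Δ h).map φ.e.toLinearMap) Γ) : GradEquiv ev od Γ Δ := by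
  have hΔ' := hΔ.map φ
  have hset := hfine H inferInstance _ hΔ' hr
  have hback : ∀ p : Submodule F A, (p.map φ.e.toLinearMap).map φ⁻¹.e.toLinearMap = p := fun p => by
    change (p.map φ.e.toLinearMap).map φ.e.symm.toLinearMap = p
    ext x
    simp
  have hne : ∀ h, Δ h ≠ ⊥ ↔ (Δ h).map φ.e.toLinearMap ≠ ⊥ := fun h => by
    rw [Ne, Ne, Submodule.map_eq_bot_iff]
  have hα : ∀ g : {g : G // Γ g ≠ ⊥}, ∃ h : {h : H // Δ h ≠ ⊥},
      (Δ h.1).map φ.e.toLinearMap = Γ g.1 := fun g => by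
    have : Γ g.1 ∈ {p : Submodule F A | p ≠ ⊥ ∧ ∃ g, Γ g = p} := ⟨g.2, g.1, rfl⟩
    rw [← hset] at this
    obtain ⟨h0, h, hh⟩ := this
    exact ⟨⟨h, (hne h).2 (by rwa [hh])⟩, hh⟩
  choose α hα using hα
  refine ⟨φ⁻¹, α, ⟨fun g g' hg => ?_, fun h => ?_⟩, fun g => ?_⟩
  · exact Subtype.ext (hΓ.injective_of_ne_bot g.2 (by rw [← hα g, hg, hα g']))
  · have : (Δ h.1).map φ.e.toLinearMap ∈
        {p : Submodule F A | p ≠ ⊥ ∧ ∃ h, (Δ h).map φ.e.toLinearMap = p} :=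
      ⟨(hne _).1 h.2, h.1, rfl⟩
    rw [hset] at this
    obtain ⟨h0, g, hg⟩ := this
    refine ⟨⟨g, by rwa [hg]⟩, Subtype.ext (hΔ'.injective_of_ne_bot ((hne _).1 (α _).2) ?_)⟩
    simp only [hα, hg]
  · rw [← hα g, hback]

end IsSuperGrading

section GradingOf

variable {n : ℕ} {w : Fin n → A} {d : Fin n → G}

lemma gradingOf_isSuperGrading (hw : LinearIndependent F w)
    (hspan : ⊤ ≤ Submodule.span F (Set.range w))
    (hpar : ∀ i, w i ∈ ev ∨ w i ∈ od)
    (hmul : ∀ (g h : G) (x y : A), x ∈ gradingOf F w d g → y ∈ gradingOf F w d h →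
      x * y ∈ gradingOf F w d (g * h)) :
    IsSuperGrading ev od (gradingOf F w d) := by
  refine isSuperGrading_iff.2 ⟨⟨fun g => ?_, ?_⟩, hmul, fun g => ?_⟩
  · have : ⨆ h, ⨆ (_ : h ≠ g), gradingOf F w d h ≤ Submodule.span F (w '' {i | d i ≠ g}) :=
      iSup₂_le fun h hh => gradingOf_le fun i hi => Submodule.subset_span ⟨i, by simp [hi, hh], rfl⟩
    refine Disjoint.mono_right this (hw.disjoint_span_image ?_)
    rw [Set.disjoint_left]
    intro i hi hi'
    exact hi' hi
  · rw [eq_top_iff]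
    refine hspan.trans (Submodule.span_le.2 ?_)
    rintro _ ⟨i, rfl⟩
    exact Submodule.mem_iSup_of_mem (d i) (mem_gradingOf i)
  · refine le_antisymm (gradingOf_le ?_) (sup_le inf_le_left inf_le_left)
    rintro i rfl
    rcases hpar i with h | h
    · exact Submodule.mem_sup_left ⟨mem_gradingOf i, h⟩
    · exact Submodule.mem_sup_right ⟨mem_gradingOf i, h⟩

/-- A grading is refined by one whose homogeneous basis consists of homogeneous elements, with
degrees obtained through a map of the grading groups. -/
lemma refines_gradingOf {H : Type} {Δ : H → Submodule F A} {d' : Fin n → H}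
    (φ : SuperAut F A ev od) (ψ : G → H)
    (hψ : ∀ i, ψ (d i) = d' i) (h : ∀ i, φ.e (w i) ∈ Δ (d' i)) :
    Refines (fun g => (gradingOf F w d g).map φ.e.toLinearMap) Δ := by
  intro g _
  refine ⟨ψ g, Submodule.map_le_iff_le_comap.2 (gradingOf_le ?_)⟩
  rintro i rfl
  rw [hψ]
  exact h i

end GradingOf

end GradingLemmas
end Kac

namespace Kac

namespace K10A

section Projections

variable {F : Type} [Field F]

variable (F) in
/-- The projections onto the two summands of the odd part of `K₁₀`. -/
def proj (b : Bool) : K10A F F →ₗ[F] K10A F F := cond b (projLeft F) (projRight F)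

variable (F) in
/-- The symplectic forms on the two summands of the odd part of `K₁₀`. -/
def omega (b : Bool) : K10A F F →ₗ[F] K10A F F →ₗ[F] F :=
  LinearMap.mk₂ F (fun x y => cond b (omegaLeft x y) (omegaRight x y))
    (fun x y z => by cases b <;> simp [omegaLeft, omegaRight] <;> ring)
    (fun c x y => by cases b <;> simp [omegaLeft, omegaRight] <;> ring)
    (fun x y z => by cases b <;> simp [omegaLeft, omegaRight] <;> ring)
    (fun c x y => by cases b <;> simp [omegaLeft, omegaRight] <;> ring)

lemma omega_true (x y : K10A F F) : omega F true x y = omegaLeft x y := rfl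

lemma omega_false (x y : K10A F F) : omega F false x y = omegaRight x y := rfl

variable (b : Bool) (x y z : K10A F F)

lemma omega_swap : omega F b y x = -omega F b x y := by
  cases b <;> simp only [omega_true, omega_false, omegaLeft, omegaRight] <;> ring

lemma omega_self : omega F b x x = 0 := by
  cases b <;> simp only [omega_true, omega_false, omegaLeft, omegaRight] <;> ring

lemma omega_proj_left : omega F b (proj F b x) y = omega F b x y := by
  cases b <;> simp [omega_true, omega_false, omegaLeft, omegaRight, proj, projLeft_apply,
    projRight_apply, bv_apply] <;> ring

lemma omega_proj_right : omega F b x (proj F b y) = omega F b x y := by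
  cases b <;> simp [omega_true, omega_false, omegaLeft, omegaRight, proj, projLeft_apply,
    projRight_apply, bv_apply]

lemma proj_proj_not : proj F b (proj F (!b) x) = 0 := by
  cases b <;> apply ext_coord <;>
    simp [proj, projLeft_apply, projRight_apply, bv_apply]

lemma proj_not_proj : proj F (!b) (proj F b x) = 0 := by
  cases b <;> apply ext_coord <;>
    simp [proj, projLeft_apply, projRight_apply, bv_apply]

lemma proj_proj : proj F b (proj F b x) = proj F b x := by
  cases b <;> apply ext_coord <;>
    simp [proj, projLeft_apply, projRight_apply, bv_apply]

lemma proj_mem_odd : proj F b x ∈ K10A.odd F F F := by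
  cases b
  · exact projRight_mem_odd x
  · exact projLeft_mem_odd x

lemma proj_add_proj_not {x : K10A F F} (hx : x ∈ K10A.odd F F F) :
    proj F b x + proj F (!b) x = x := by
  rw [mem_odd_iff_proj] at hx
  cases b
  · rw [add_comm]; exact hx
  · exact hx

variable {b x y z}

lemma omega_eq_zero_left (hx : proj F b x = 0) : omega F b x y = 0 := by
  rw [← omega_proj_left, hx, map_zero, LinearMap.zero_apply]

lemma omega_eq_zero_right (hy : proj F b y = 0) : omega F b x y = 0 := by
  rw [← omega_proj_right, hy, map_zero]

lemma exists_omega_ne_zero (hx : proj F b x ≠ 0) :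
    ∃ y ∈ K10A.odd F F F, proj F (!b) y = 0 ∧ omega F b x y ≠ 0 := by
  by_contra! h
  have h' : ∀ y, omega F b x y = 0 := fun y => by
    rw [← omega_proj_right]
    exact h _ (proj_mem_odd b y) (proj_not_proj b y)
  apply hx
  cases b
  · have h8 := h' (K10A.bv F 8)
    have h9 := h' (K10A.bv F 9)
    simp [omega_false, omegaRight, bv_apply] at h8 h9
    simp [proj, projRight_apply, h8, h9]
  · have h6 := h' (K10A.bv F 6)
    have h7 := h' (K10A.bv F 7)
    simp [omega_true, omegaLeft, bv_apply] at h6 h7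
    simp [proj, projLeft_apply, h6, h7]

lemma odd_triple_proj (hchar : (2 : F) ≠ 0) (b : Bool) (hx : x ∈ K10A.odd F F F)
    (hy : y ∈ K10A.odd F F F) (hz : z ∈ K10A.odd F F F) :
    (8 : F) • ((x * y) * z) = (omega F b x y + omega F (!b) x y) • z
      + (omega F (!b) y z • proj F b x - omega F (!b) x z • proj F b y)
      + (omega F b y z • proj F (!b) x - omega F b x z • proj F (!b) y) := by
  rw [odd_triple hchar hx hy hz]
  cases b
  · simp only [Bool.not_false, omega_true, omega_false, proj, cond_true, cond_false]
    module
  · rfl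

lemma odd_triple_self (hchar : (2 : F) ≠ 0) (b : Bool) (hx : x ∈ K10A.odd F F F)
    (hy : y ∈ K10A.odd F F F) :
    (8 : F) • ((x * y) * x) = omega F b x y • proj F b x + omega F (!b) x y • proj F (!b) x := by
  rw [odd_triple_proj hchar b hx hy hx, omega_self, omega_self, omega_swap _ x, omega_swap _ x]
  linear_combination (norm := module) (-(omega F b x y + omega F (!b) x y)) • proj_add_proj_not b hx

lemma odd_triple_self_right (hchar : (2 : F) ≠ 0) (b : Bool) (hx : x ∈ K10A.odd F F F)
    (hy : y ∈ K10A.odd F F F) :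
    (8 : F) • ((x * y) * y) = omega F b x y • proj F b y + omega F (!b) x y • proj F (!b) y := by
  rw [odd_triple_proj hchar b hx hy hy, omega_self, omega_self]
  linear_combination (norm := module) (-(omega F b x y + omega F (!b) x y)) • proj_add_proj_not b hy

lemma odd_triple_triple (hchar : (2 : F) ≠ 0) (hx : x ∈ K10A.odd F F F)
    (hy : y ∈ K10A.odd F F F) :
    (8 : F) • ((x * y) * ((8 : F) • ((x * y) * x))) =
      (2 * (omega F true x y + omega F false x y)) • ((8 : F) • ((x * y) * x))
      + (omega F true x y * omega F false x y - (omega F true x y + omega F false x y) ^ 2) •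
        x := by
  have h1 := odd_triple_self hchar true hx hy
  have hodd : (8 : F) • ((x * y) * x) ∈ K10A.odd F F F := by
    rw [h1]
    exact add_mem (Submodule.smul_mem _ _ (proj_mem_odd _ _))
      (Submodule.smul_mem _ _ (proj_mem_odd _ _))
  rw [odd_triple_proj hchar true hx hy hodd, h1]
  simp only [map_add, map_smul, omega_self, smul_eq_mul, omega_proj_right]
  have e1 : omega F false x (proj F true x) = 0 := omega_eq_zero_right (proj_not_proj true x)
  have e2 : omega F false y (proj F true x) = 0 := omega_eq_zero_right (proj_not_proj true x)
  have e3 : omega F true x (proj F false x) = 0 := omega_eq_zero_right (proj_not_proj false x)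
  have e4 : omega F true y (proj F false x) = 0 := omega_eq_zero_right (proj_not_proj false x)
  simp only [Bool.not_true, e1, e2, e3, e4]
  rw [omega_swap _ x y, omega_swap _ x y]
  have := proj_add_proj_not true hx
  simp only [Bool.not_true] at this
  linear_combination (norm := module) (omega F true x y * omega F false x y
    - (omega F true x y + omega F false x y) ^ 2) • this

end Projections

section Homogeneous

variable {F G : Type} [Field F] [CommGroup G] {Γ : G → Submodule F (K10A F F)}
  {x y z : K10A F F} {p q r : G}

lemma bv_zero_mem (hΓ : IsSuperGrading (K10A.even F F F) (K10A.odd F F F) Γ) :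
    K10A.bv F 0 ∈ Γ 1 := by
  obtain ⟨π, hπ0, hπ1, hπ2⟩ := hΓ.exists_proj
  have key : (mulBilin F) (π 1 (K10A.bv F 0)) = LinearMap.id := hΓ.linearMap_ext fun h a ha => by
    have h1 : (π h) ∘ₗ (mulBilin F).flip a = (mulBilin F).flip a ∘ₗ π 1 :=
      hΓ.linearMap_ext fun g x hx => by
        have hxa := hΓ.mul_mem hx ha
        simp only [LinearMap.comp_apply, LinearMap.flip_apply, mulBilin_apply]
        by_cases hg : g = 1
        · subst hg
          rw [one_mul] at hxa
          rw [hπ1 _ _ hx, hπ1 _ _ hxa]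
        · rw [hπ2 1 g (Ne.symm hg) x hx, hπ2 h (g * h) (by simpa using hg) _ hxa]
          exact (((mulBilin F).flip a).map_zero).symm
    have h2 := LinearMap.congr_fun h1 (K10A.bv F 0)
    simp only [LinearMap.comp_apply, LinearMap.flip_apply, mulBilin_apply, K10A.one_mul,
      hπ1 _ _ ha] at h2
    simp [← h2]
  have h3 := LinearMap.congr_fun key (K10A.bv F 0)
  simp only [mulBilin_apply, K10A.mul_one, LinearMap.id_apply] at h3
  rw [← h3]
  exact hπ0 _ _

lemma exists_homogeneous_odd (hΓ : IsSuperGrading (K10A.even F F F) (K10A.odd F F F) Γ)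
    (f : K10A F F →ₗ[F] F) (hx : x ∈ K10A.odd F F F) (hf : f x ≠ 0) :
    ∃ g, ∃ y ∈ Γ g, y ∈ K10A.odd F F F ∧ f y ≠ 0 := by
  by_contra! h
  have h0 : f ∘ₗ (proj F true + proj F false) = 0 := hΓ.linearMap_ext fun g x hx => by
    rw [hΓ.2.2 g] at hx
    obtain ⟨e, ⟨-, he⟩, o, ⟨hog, ho⟩, rfl⟩ := Submodule.mem_sup.1 hx
    have he0 : proj F true e + proj F false e = 0 := by
      obtain ⟨h6, h7, h8, h9⟩ := (mem_even_iff e).1 he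
      simp [proj, projLeft_apply, projRight_apply, h6, h7, h8, h9]
    rw [map_add, LinearMap.comp_apply, LinearMap.comp_apply, LinearMap.add_apply, he0,
      LinearMap.add_apply]
    have hsum : proj F true o + proj F false o = o := proj_add_proj_not true ho
    rw [hsum, map_zero, h g o hog ho, add_zero, LinearMap.zero_apply]
  have h1 := LinearMap.congr_fun h0 x
  have hsum : proj F true x + proj F false x = x := proj_add_proj_not true hx
  rw [LinearMap.comp_apply, LinearMap.add_apply, hsum] at h1
  exact hf h1

variable (hchar : (2 : F) ≠ 0)
include hchar

lemma eight_ne_zero : (8 : F) ≠ 0 := by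
  have : (8 : F) = 2 ^ 3 := by norm_num
  rw [this]
  exact pow_ne_zero 3 hchar

lemma degree_mul_eq_one (hΓ : IsSuperGrading (K10A.even F F F) (K10A.odd F F F) Γ)
    (b : Bool) (hxp : x ∈ Γ p) (hx : x ∈ K10A.odd F F F) (hyq : y ∈ Γ q) (hy : y ∈ K10A.odd F F F)
    (hxy : omega F b x y + omega F (!b) x y ≠ 0) : p * q = 1 := by
  by_contra hne
  have hb : omega F true x y + omega F false x y ≠ 0 := by
    cases b
    · rwa [add_comm]
    · exact hxy
  obtain ⟨π, -, hπ1, hπ2⟩ := hΓ.exists_proj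
  have hD : (8 : F) • ((x * y) * x) ∈ Γ (p * q * p) :=
    Submodule.smul_mem _ _ (hΓ.mul_mem (hΓ.mul_mem hxp hyq) hxp)
  have hDD : (8 : F) • ((x * y) * ((8 : F) • ((x * y) * x))) ∈ Γ (p * q * (p * q * p)) :=
    Submodule.smul_mem _ _ (hΓ.mul_mem (hΓ.mul_mem hxp hyq) hD)
  have h := odd_triple_triple hchar hx hy
  have hself := odd_triple_self hchar true hx hy
  generalize (8 : F) • ((x * y) * x) = w at h hD hDD hself
  replace h := congrArg (π (p * q * p)) h
  rw [hπ2 _ _ (by simpa using hne) _ hDD, map_add, map_smul, map_smul, hπ1 _ _ hD,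
    hπ2 (p * q * p) p (by simpa using hne) x hxp, smul_zero, add_zero, eq_comm,
    smul_eq_zero_iff_right (mul_ne_zero hchar hb), hself] at h
  have key : ∀ c, omega F c x y = 0 := fun c => by
    have hc := congrArg (proj F c) h
    rw [map_add, map_smul, map_smul, map_zero] at hc
    have : omega F c x y • proj F c x = 0 := by
      cases c
      · have h0 : proj F false (proj F true x) = 0 := proj_not_proj true x
        rwa [h0, smul_zero, zero_add, Bool.not_true, proj_proj] at hc
      · have h0 : proj F true (proj F false x) = 0 := proj_not_proj false x
        rwa [Bool.not_true, h0, smul_zero, add_zero, proj_proj] at hc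
    rcases smul_eq_zero.1 this with h | h
    · exact h
    · exact omega_eq_zero_left h
  simp [key] at hb

end Homogeneous

end K10A

end Kac

namespace Kac

namespace K10A

section SymplecticBases

variable {F G : Type} [Field F] [CommGroup G] {Γ : G → Submodule F (K10A F F)}
  {x y z : K10A F F} {p q r : G} (hchar : (2 : F) ≠ 0)
include hchar

/-- A nonzero homogeneous element of one of the summands of the odd part extends to a homogeneous
symplectic basis of this summand, and then the other summand is graded. -/
lemma exists_dual_of_proj_not_eq_zero
    (hΓ : IsSuperGrading (K10A.even F F F) (K10A.odd F F F) Γ)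
    (b : Bool) (hxp : x ∈ Γ p) (hx : x ∈ K10A.odd F F F) (hx0 : proj F (!b) x = 0) (hne : x ≠ 0) :
    (∃ y ∈ Γ p⁻¹, y ∈ K10A.odd F F F ∧ proj F (!b) y = 0 ∧ omega F b x y = 1) ∧
    ∀ r, ∀ z ∈ Γ r, z ∈ K10A.odd F F F → proj F (!b) z ∈ Γ r := by
  have h8 := eight_ne_zero hchar
  have hxb : proj F b x = x := by
    have := proj_add_proj_not b hx
    rwa [hx0, add_zero] at this
  have hω : ∀ y, omega F (!b) x y = 0 := fun y => omega_eq_zero_left hx0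
  have hdual : ∃ y ∈ Γ p⁻¹, y ∈ K10A.odd F F F ∧ proj F (!b) y = 0 ∧ omega F b x y = 1 := by
    obtain ⟨y₀, hy₀, -, hxy₀⟩ := exists_omega_ne_zero (b := b) (x := x) (by rwa [hxb])
    obtain ⟨q, y, hyq, hy, hxy⟩ := exists_homogeneous_odd hΓ (omega F b x) hy₀ hxy₀
    have hpq : p * q = 1 :=
      degree_mul_eq_one hchar hΓ b hxp hx hyq hy (by rwa [hω, add_zero])
    have h1 : (8 : F) • ((x * y) * y) ∈ Γ (p * q * q) :=
      Submodule.smul_mem _ _ (hΓ.mul_mem (hΓ.mul_mem hxp hyq) hyq)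
    rw [odd_triple_self_right hchar b hx hy, hω, zero_smul, add_zero, hpq, one_mul,
      Submodule.smul_mem_iff _ hxy, eq_inv_of_mul_eq_one_right hpq] at h1
    refine ⟨(omega F b x y)⁻¹ • proj F b y, Submodule.smul_mem _ _ h1,
      Submodule.smul_mem _ _ (proj_mem_odd _ _), ?_, ?_⟩
    · rw [map_smul, proj_not_proj, smul_zero]
    · rw [map_smul, omega_proj_right, smul_eq_mul, inv_mul_cancel₀ hxy]
  refine ⟨hdual, fun r z hzr hz => ?_⟩
  obtain ⟨y, hyp, hy, hy0, hxy⟩ := hdual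
  have h1 : (8 : F) • ((x * z) * y) ∈ Γ (p * r * p⁻¹) :=
    Submodule.smul_mem _ _ (hΓ.mul_mem (hΓ.mul_mem hxp hzr) hyp)
  rw [odd_triple_proj hchar b hx hz hy, hω, hω, omega_eq_zero_right hy0, hx0, hxy,
    mul_inv_cancel_comm, smul_zero, zero_smul, zero_smul, sub_zero, add_zero, add_zero, one_smul,
    zero_sub] at h1
  by_cases hxz : omega F b x z = 0
  · rwa [hxz, zero_smul, zero_add, Submodule.neg_mem_iff] at h1
  · have hpr := degree_mul_eq_one hchar hΓ b hxp hx hzr hz (by rwa [hω, add_zero])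
    rw [← eq_inv_of_mul_eq_one_right hpr] at hyp
    rwa [Submodule.add_mem_iff_right _ (Submodule.smul_mem _ _ hyp), Submodule.neg_mem_iff] at h1

lemma exists_symplectic_of_proj_not_eq_zero
    (hΓ : IsSuperGrading (K10A.even F F F) (K10A.odd F F F) Γ)
    (b : Bool) (hxp : x ∈ Γ p) (hx : x ∈ K10A.odd F F F) (hx0 : proj F (!b) x = 0) (hne : x ≠ 0) :
    ∃ m n, ∀ c, omega F c m n = 1 ∧ ∃ g, proj F c m ∈ Γ g ∧ proj F c n ∈ Γ g⁻¹ := by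
  obtain ⟨⟨y, hyp, hy, hy0, hxy⟩, hproj⟩ :=
    exists_dual_of_proj_not_eq_zero hchar hΓ b hxp hx hx0 hne
  obtain ⟨x', hx'o, hx'⟩ : ∃ x' ∈ K10A.odd F F F, proj F (!b) x' ≠ 0 := by
    cases b
    · refine ⟨proj F true (K10A.bv F 6), proj_mem_odd _ _, fun h => ?_⟩
      simpa [proj, projLeft_apply, bv_apply] using congrFun h 6
    · refine ⟨proj F false (K10A.bv F 8), proj_mem_odd _ _, fun h => ?_⟩
      simpa [proj, projRight_apply, bv_apply] using congrFun h 8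
  obtain ⟨t, ht, -, hx't⟩ := exists_omega_ne_zero hx'
  rw [omega_swap, neg_ne_zero] at hx't
  obtain ⟨q, z, hzq, hz, htz⟩ := exists_homogeneous_odd hΓ (omega F (!b) t) hx'o hx't
  have hz0 : proj F (!b) z ≠ 0 := fun h => htz (omega_eq_zero_right h)
  obtain ⟨⟨y', hyq, hy', hy'0, hzy⟩, -⟩ := exists_dual_of_proj_not_eq_zero hchar hΓ (!b)
    (hproj q z hzq hz) (proj_mem_odd _ _) (by rw [Bool.not_not]; exact proj_proj_not b z) hz0
  rw [Bool.not_not] at hy'0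
  have hxb : proj F b x = x := by
    have := proj_add_proj_not b hx
    rwa [hx0, add_zero] at this
  have hyb : proj F b y = y := by
    have := proj_add_proj_not b hy
    rwa [hy0, add_zero] at this
  have hyb' : proj F (!b) y' = y' := by
    have := proj_add_proj_not b hy'
    rwa [hy'0, zero_add] at this
  have hz0' : proj F b (proj F (!b) z) = 0 := proj_proj_not b z
  refine ⟨x + proj F (!b) z, y + y', fun c => ?_⟩
  obtain rfl | rfl : c = b ∨ c = !b := by cases b <;> cases c <;> simp
  · refine ⟨?_, p, ?_, ?_⟩
    · rw [map_add, LinearMap.map_add₂, LinearMap.map_add₂, hxy, omega_eq_zero_right hy'0,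
        omega_eq_zero_left hz0', omega_eq_zero_left hz0', add_zero, add_zero, add_zero]
    · rwa [map_add, hz0', hxb, add_zero]
    · rwa [map_add, hyb, hy'0, add_zero]
  · refine ⟨?_, q, ?_, ?_⟩
    · rw [map_add, LinearMap.map_add₂, LinearMap.map_add₂, hzy, omega_eq_zero_left hx0,
        omega_eq_zero_left hx0, omega_eq_zero_right hy0, zero_add, zero_add, zero_add]
    · rw [map_add, hx0, proj_proj, zero_add]
      exact hproj q z hzq hz
    · rwa [map_add, hyb', hy0, zero_add]

/-- If `x` is homogeneous, so is the element obtained from `x` by changing the sign of its second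
component. -/
lemma exists_mem_proj_sub_proj
    (hΓ : IsSuperGrading (K10A.even F F F) (K10A.odd F F F) Γ)
    (hxp : x ∈ Γ p) (hx : x ∈ K10A.odd F F F) (hx0 : proj F true x ≠ 0) :
    ∃ k, proj F true x - proj F false x ∈ Γ k := by
  obtain ⟨y, hy, hy0, hxy⟩ := exists_omega_ne_zero hx0
  obtain ⟨r, z, hzr, hz, hxz⟩ := exists_homogeneous_odd hΓ (omega F true x - omega F false x) hy
    (by
      have h0 : omega F false x y = 0 := omega_eq_zero_right hy0
      rwa [LinearMap.sub_apply, h0, sub_zero])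
  rw [LinearMap.sub_apply] at hxz
  refine ⟨p * r * p, ?_⟩
  have h1 : (8 : F) • ((x * z) * x) ∈ Γ (p * r * p) :=
    Submodule.smul_mem _ _ (hΓ.mul_mem (hΓ.mul_mem hxp hzr) hxp)
  have h2 : (omega F true x z + omega F false x z) • x ∈ Γ (p * r * p) := by
    by_cases h0 : omega F true x z + omega F false x z = 0
    · rw [h0, zero_smul]; exact zero_mem _
    · rw [degree_mul_eq_one hchar hΓ true hxp hx hzr hz h0, one_mul]
      exact Submodule.smul_mem _ _ hxp
  rw [odd_triple_self hchar true hx hz] at h1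
  rw [← Submodule.smul_mem_iff _ hxz]
  have hsum := proj_add_proj_not true hx
  rw [Bool.not_true] at *
  convert sub_mem (Submodule.smul_mem _ (2 : F) h1) h2 using 1
  linear_combination (norm := module) (-(omega F true x z + omega F false x z)) • hsum

/-- If no nonzero homogeneous odd element lies in one of the summands, there is a pair of
homogeneous elements giving symplectic bases of both summands. -/
lemma exists_symplectic_of_forall_proj_ne_zero
    (hΓ : IsSuperGrading (K10A.even F F F) (K10A.odd F F F) Γ)
    (h : ∀ b p x, x ∈ Γ p → x ∈ K10A.odd F F F → proj F (!b) x = 0 → x = 0) :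
    ∃ m n, m ∈ K10A.odd F F F ∧ n ∈ K10A.odd F F F ∧ (∀ c, omega F c m n = 1) ∧
      ∃ p k, m ∈ Γ p ∧ n ∈ Γ p⁻¹ ∧
        proj F true m - proj F false m ∈ Γ k ∧ proj F true n - proj F false n ∈ Γ k⁻¹ := by
  obtain ⟨p, x, hxp, hx, hx6⟩ := exists_homogeneous_odd hΓ (omega F true (K10A.bv F 6))
    (x := proj F true (K10A.bv F 7)) (proj_mem_odd _ _)
    (by rw [omega_proj_right]; simp [omega_true, omegaLeft, bv_apply])
  have hx0 : proj F true x ≠ 0 := fun h0 => hx6 (omega_eq_zero_right h0)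
  obtain ⟨y₀, hy₀, hy₀0, hxy₀⟩ := exists_omega_ne_zero hx0
  obtain ⟨q, y, hyq, hy, hxy⟩ := exists_homogeneous_odd hΓ (omega F true x + omega F false x) hy₀
    (by
      have h0 : omega F false x y₀ = 0 := omega_eq_zero_right hy₀0
      rwa [LinearMap.add_apply, h0, add_zero])
  rw [LinearMap.add_apply] at hxy
  have hpq : p * q = 1 := degree_mul_eq_one hchar hΓ true hxp hx hyq hy hxy
  have hx2 : (omega F true x y - omega F false x y) • proj F true x = 0 := by
    refine h true p _ ?_ (Submodule.smul_mem _ _ (proj_mem_odd _ _)) ?_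
    · have h1 : (8 : F) • ((x * y) * x) ∈ Γ (p * q * p) :=
        Submodule.smul_mem _ _ (hΓ.mul_mem (hΓ.mul_mem hxp hyq) hxp)
      rw [odd_triple_self hchar true hx hy, hpq, one_mul] at h1
      convert sub_mem h1 (Submodule.smul_mem _ (omega F false x y) hxp) using 1
      have hsum := proj_add_proj_not true hx
      rw [Bool.not_true] at *
      linear_combination (norm := module) (-omega F false x y) • hsum
    · rw [map_smul, proj_not_proj, smul_zero]
  have hω : omega F true x y = omega F false x y :=
    sub_eq_zero.1 ((smul_eq_zero.1 hx2).resolve_right hx0)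
  have hne : omega F true x y ≠ 0 := by
    intro h0
    rw [← hω, h0, add_zero] at hxy
    exact hxy rfl
  set n := (omega F true x y)⁻¹ • y with hn
  have hno : n ∈ K10A.odd F F F := Submodule.smul_mem _ _ hy
  have hnp : n ∈ Γ p⁻¹ := by
    rw [← eq_inv_of_mul_eq_one_right hpq]
    exact Submodule.smul_mem _ _ hyq
  have hxn : ∀ c, omega F c x n = 1 := fun c => by
    rw [hn, map_smul, smul_eq_mul]
    cases c
    · rw [← hω, inv_mul_cancel₀ hne]
    · rw [inv_mul_cancel₀ hne]
  obtain ⟨k, hk⟩ := exists_mem_proj_sub_proj hchar hΓ hxp hx hx0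
  obtain ⟨k', hk'⟩ := exists_mem_proj_sub_proj hchar hΓ hnp hno (fun h0 => by
    simpa [omega_eq_zero_right h0] using hxn true)
  have hkk' : k * k' = 1 := by
    refine degree_mul_eq_one hchar hΓ true hk (sub_mem (proj_mem_odd _ _) (proj_mem_odd _ _))
      hk' (sub_mem (proj_mem_odd _ _) (proj_mem_odd _ _)) ?_
    have e1 : proj F true (proj F false n) = 0 := proj_not_proj false n
    have e2 : proj F false (proj F true n) = 0 := proj_not_proj true n
    have e3 : proj F true (proj F false x) = 0 := proj_not_proj false x
    have e4 : proj F false (proj F true x) = 0 := proj_not_proj true x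
    simp only [Bool.not_true, map_sub, LinearMap.sub_apply, omega_proj_left, omega_proj_right,
      omega_eq_zero_left e3, omega_eq_zero_left e4, omega_eq_zero_right e1,
      omega_eq_zero_right e2, hxn]
    norm_num
    exact hchar
  exact ⟨x, n, hx, hno, hxn, p, k, hxp, hnp, hk, eq_inv_of_mul_eq_one_right hkk' ▸ hk'⟩

end SymplecticBases

end K10A

end Kac

namespace Kac

section BasisGradings

variable {F A G : Type} [Field F] [AddCommGroup A] [Module F A] [Mul A] [CommGroup G]
  {ev od : Submodule F A} {n : ℕ}

lemma gradingOf_basis_isSuperGrading (w : Module.Basis (Fin n) F A) (d : Fin n → G)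
    (hpar : ∀ i, w i ∈ ev ∨ w i ∈ od)
    (hmul : ∀ x y k, (∀ i j, d i * d j = d k → w.repr x i * w.repr y j = 0) →
      w.repr (x * y) k = 0) :
    IsSuperGrading ev od (gradingOf F w d) := by
  have hmem : ∀ g x, x ∈ gradingOf F w d g ↔ ∀ i, d i ≠ g → w.repr x i = 0 := fun g x => by
    rw [gradingOf, w.mem_span_image, Finsupp.support_subset_iff]
    rfl
  refine gradingOf_isSuperGrading w.linearIndependent w.span_eq.ge hpar fun g h x y hx hy => ?_
  rw [hmem] at hx hy ⊢
  refine fun k hk => hmul x y k fun i j hij => ?_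
  by_cases hi : d i = g
  · rw [hy j (by rintro rfl; exact hk (by rw [← hij, hi])), mul_zero]
  · rw [hx i hi, zero_mul]

/-- A component of dimension one is not split by a refinement. -/
lemma IsSuperGrading.exists_mem_of_refines {H : Type} [CommGroup H] {w : Fin n → A} {d : Fin n → G}
    {Δ : H → Submodule F A} (hw : LinearIndependent F w)
    (hΓ : IsSuperGrading ev od (gradingOf F w d)) (hΔ : IsSuperGrading ev od Δ)
    (hr : Refines Δ (gradingOf F w d)) (i : Fin n) (hi : ∀ j, d j = d i → j = i) :
    ∃ h, w i ∈ Δ h := by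
  obtain ⟨h, hh, hle⟩ := hΓ.exists_le_of_refines hΔ hr
    ((gradingOf_ne_bot_iff hw).2 ⟨i, rfl⟩ : gradingOf F w d (d i) ≠ ⊥)
  obtain ⟨x, hx, hx0⟩ := Submodule.exists_mem_ne_zero_of_ne_bot hh
  have hspan : gradingOf F w d (d i) ≤ Submodule.span F {w i} :=
    gradingOf_le fun j hj => by
      rw [hi j hj]
      exact Submodule.mem_span_singleton_self _
  obtain ⟨c, rfl⟩ := Submodule.mem_span_singleton.1 (hspan (hle hx))
  have hc : c ≠ 0 := by
    rintro rfl
    exact hx0 (zero_smul _ _)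
  exact ⟨h, (Submodule.smul_mem_iff _ hc).1 hx⟩

lemma isFine_gradingOf {w : Fin n → A} {d : Fin n → G} (hw : LinearIndependent F w)
    (hΓ : IsSuperGrading ev od (gradingOf F w d))
    (h : ∀ (H : Type) (_ : CommGroup H) (Δ : H → Submodule F A), IsSuperGrading ev od Δ →
      Refines Δ (gradingOf F w d) →
      ∃ d' : Fin n → H, (∀ i, w i ∈ Δ (d' i)) ∧ ∀ i j, d i = d j → d' i = d' j) :
    IsFine ev od (gradingOf F w d) := by
  intro H _ Δ hΔ hr
  refine hΓ.components_eq hΔ hr fun g k hk hle => ?_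
  obtain ⟨d', hmem, hd'⟩ := h H _ Δ hΔ hr
  obtain ⟨i, rfl⟩ := (gradingOf_ne_bot_iff hw).1 (ne_bot_of_le_ne_bot hk hle)
  have hle' : gradingOf F w d (d i) ≤ Δ (d' i) :=
    gradingOf_le fun j hj => hd' j i hj ▸ hmem j
  obtain ⟨x, hx, hx0⟩ := Submodule.exists_mem_ne_zero_of_ne_bot hk
  rwa [hΔ.degree_unique hx (hle' (hle hx)) hx0]

end BasisGradings

namespace K10A

variable {F G : Type} [Field F] [CommGroup G]

variable (F) in
/-- The standard basis of `K₁₀`. -/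
def stdBasis : Module.Basis (Fin 10) F (K10A F F) := Pi.basisFun F (Fin 10)

lemma stdBasis_repr (x : K10A F F) (i : Fin 10) : (stdBasis F).repr x i = x i := rfl

variable (F) in
lemma coe_stdBasis : ⇑(stdBasis F) = K10A.bv F := by
  funext i
  exact Pi.basisFun_apply F (Fin 10) i

variable (F) in
/-- The vectors that are homogeneous in the second kind of gradings on `K₁₀`. -/
def mixedVec : Fin 10 → K10A F F :=
  ![K10A.bv F 0, K10A.bv F 1, K10A.bv F 3 - K10A.bv F 4,
    K10A.bv F 3 + K10A.bv F 4, K10A.bv F 2, K10A.bv F 5,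
    K10A.bv F 6 + K10A.bv F 8, K10A.bv F 7 + K10A.bv F 9,
    K10A.bv F 6 - K10A.bv F 8, K10A.bv F 7 - K10A.bv F 9]

variable (F) in
lemma mixedVec_apply :
    mixedVec F 0 = K10A.bv F 0 ∧ mixedVec F 1 = K10A.bv F 1 ∧
    mixedVec F 2 = K10A.bv F 3 - K10A.bv F 4 ∧ mixedVec F 3 = K10A.bv F 3 + K10A.bv F 4 ∧
    mixedVec F 4 = K10A.bv F 2 ∧ mixedVec F 5 = K10A.bv F 5 ∧
    mixedVec F 6 = K10A.bv F 6 + K10A.bv F 8 ∧ mixedVec F 7 = K10A.bv F 7 + K10A.bv F 9 ∧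
    mixedVec F 8 = K10A.bv F 6 - K10A.bv F 8 ∧ mixedVec F 9 = K10A.bv F 7 - K10A.bv F 9 :=
  ⟨rfl, rfl, rfl, rfl, rfl, rfl, rfl, rfl, rfl, rfl⟩

/-- The degrees of the vectors `bv F i` in a grading of the first kind. -/
def degFst (g₁ g₂ : G) : Fin 10 → G :=
  ![1, 1, g₁ * g₂, g₁ * g₂⁻¹, g₁⁻¹ * g₂, g₁⁻¹ * g₂⁻¹, g₁, g₁⁻¹, g₂, g₂⁻¹]

/-- The degrees of the vectors `mixedVec F i` in a grading of the second kind. -/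
def degSnd (g h : G) : Fin 10 → G :=
  ![1, 1, 1, h, g * g * h, g⁻¹ * g⁻¹ * h, g, g⁻¹, g * h, g⁻¹ * h]

lemma gamma1_eq (g₁ g₂ : G) : K10A.gamma1 F g₁ g₂ = gradingOf F (stdBasis F) (degFst g₁ g₂) := by
  rw [coe_stdBasis]; rfl

lemma gamma2_eq (g h : G) : K10A.gamma2 F g h = gradingOf F (mixedVec F) (degSnd g h) := rfl

lemma forall_fin_ten {P : Fin 10 → Prop} (h0 : P 0) (h1 : P 1) (h2 : P 2) (h3 : P 3) (h4 : P 4)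
    (h5 : P 5) (h6 : P 6) (h7 : P 7) (h8 : P 8) (h9 : P 9) : ∀ i, P i := by
  intro i
  fin_cases i <;> assumption

/-- The vector with given coordinates with respect to `mixedVec`. -/
def ofMixed (a : Fin 10 → F) : K10A F F :=
  ![a 0, a 1, a 4, a 2 + a 3, a 3 - a 2, a 5, a 6 + a 8, a 7 + a 9, a 6 - a 8, a 7 - a 9]

/-- The coordinates of a vector with respect to `mixedVec`. -/
def toMixed (x : K10A F F) : Fin 10 → F :=
  ![x 0, x 1, 2⁻¹ * (x 3 - x 4), 2⁻¹ * (x 3 + x 4), x 2, x 5, 2⁻¹ * (x 6 + x 8),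
    2⁻¹ * (x 7 + x 9), 2⁻¹ * (x 6 - x 8), 2⁻¹ * (x 7 - x 9)]

lemma ofMixed_apply (a : Fin 10 → F) :
    ofMixed a 0 = a 0 ∧ ofMixed a 1 = a 1 ∧ ofMixed a 2 = a 4 ∧ ofMixed a 3 = a 2 + a 3 ∧
    ofMixed a 4 = a 3 - a 2 ∧ ofMixed a 5 = a 5 ∧ ofMixed a 6 = a 6 + a 8 ∧
    ofMixed a 7 = a 7 + a 9 ∧ ofMixed a 8 = a 6 - a 8 ∧ ofMixed a 9 = a 7 - a 9 :=
  ⟨rfl, rfl, rfl, rfl, rfl, rfl, rfl, rfl, rfl, rfl⟩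

lemma toMixed_apply (x : K10A F F) :
    toMixed x 0 = x 0 ∧ toMixed x 1 = x 1 ∧ toMixed x 2 = 2⁻¹ * (x 3 - x 4) ∧
    toMixed x 3 = 2⁻¹ * (x 3 + x 4) ∧ toMixed x 4 = x 2 ∧ toMixed x 5 = x 5 ∧
    toMixed x 6 = 2⁻¹ * (x 6 + x 8) ∧ toMixed x 7 = 2⁻¹ * (x 7 + x 9) ∧
    toMixed x 8 = 2⁻¹ * (x 6 - x 8) ∧ toMixed x 9 = 2⁻¹ * (x 7 - x 9) :=
  ⟨rfl, rfl, rfl, rfl, rfl, rfl, rfl, rfl, rfl, rfl⟩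

lemma toMixed_ofMixed (hchar : (2 : F) ≠ 0) (a : Fin 10 → F) : toMixed (ofMixed a) = a := by
  have ht : 2 * (2⁻¹ : F) = 1 := mul_inv_cancel₀ hchar
  funext i
  revert i
  refine forall_fin_ten ?_ ?_ ?_ ?_ ?_ ?_ ?_ ?_ ?_ ?_ <;>
    simp only [toMixed_apply, ofMixed_apply] <;>
    generalize (2⁻¹ : F) = t at ht <;> grind

lemma ofMixed_toMixed (hchar : (2 : F) ≠ 0) (x : K10A F F) : ofMixed (toMixed x) = x := by
  have ht : 2 * (2⁻¹ : F) = 1 := mul_inv_cancel₀ hchar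
  apply ext_coord <;>
    simp only [toMixed_apply, ofMixed_apply] <;>
    generalize (2⁻¹ : F) = t at ht <;> grind

/-- The basis of `K₁₀` whose vectors are homogeneous in the second kind of gradings. -/
def mixedBasis (hchar : (2 : F) ≠ 0) : Module.Basis (Fin 10) F (K10A F F) :=
  Module.Basis.ofEquivFun
    { toFun := toMixed
      map_add' := fun x y => by
        funext i
        revert i
        refine forall_fin_ten ?_ ?_ ?_ ?_ ?_ ?_ ?_ ?_ ?_ ?_ <;>
          simp only [toMixed_apply, add_apply, Pi.add_apply] <;> ring
      map_smul' := fun c x => by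
        funext i
        revert i
        refine forall_fin_ten ?_ ?_ ?_ ?_ ?_ ?_ ?_ ?_ ?_ ?_ <;>
          simp only [toMixed_apply, smul_apply, Pi.smul_apply, smul_eq_mul, RingHom.id_apply] <;>
          ring
      invFun := ofMixed
      left_inv := ofMixed_toMixed hchar
      right_inv := toMixed_ofMixed hchar }

lemma mixedBasis_repr (hchar : (2 : F) ≠ 0) (x : K10A F F) (i : Fin 10) :
    (mixedBasis hchar).repr x i = toMixed x i := rfl

lemma coe_mixedBasis (hchar : (2 : F) ≠ 0) : ⇑(mixedBasis hchar) = mixedVec F := by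
  rw [mixedBasis, Module.Basis.coe_ofEquivFun]
  funext i
  change ofMixed (Pi.single i 1) = mixedVec F i
  revert i
  refine forall_fin_ten ?_ ?_ ?_ ?_ ?_ ?_ ?_ ?_ ?_ ?_ <;> apply ext_coord <;>
    simp [ofMixed_apply, mixedVec_apply, bv_apply]

lemma gamma1_isSuperGrading :
    IsSuperGrading (K10A.even F F F) (K10A.odd F F F)
      (K10A.gamma1 F (Multiplicative.ofAdd ((1, 0) : ℤ × ℤ))
        (Multiplicative.ofAdd ((0, 1) : ℤ × ℤ))) := by
  rw [gamma1_eq]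
  refine gradingOf_basis_isSuperGrading _ _ ?_ fun x y => ?_
  · rw [coe_stdBasis]
    refine forall_fin_ten ?_ ?_ ?_ ?_ ?_ ?_ ?_ ?_ ?_ ?_ <;>
      simp [mem_even_iff, mem_odd_iff, bv_apply]
  · simp only [stdBasis_repr]
    refine forall_fin_ten ?_ ?_ ?_ ?_ ?_ ?_ ?_ ?_ ?_ ?_ <;> intro z <;>
    simp +decide only [mul_apply_zero, mul_apply_one, mul_apply_two, mul_apply_three,
      mul_apply_four, mul_apply_five, mul_apply_six, mul_apply_seven, mul_apply_eight,
      mul_apply_nine, z] <;> ring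

lemma gamma2_isSuperGrading (hchar : (2 : F) ≠ 0) :
    IsSuperGrading (K10A.even F F F) (K10A.odd F F F)
      (K10A.gamma2 F (Multiplicative.ofAdd ((1, 0) : ℤ × ZMod 2))
        (Multiplicative.ofAdd ((0, 1) : ℤ × ZMod 2))) := by
  rw [gamma2_eq, ← coe_mixedBasis hchar]
  refine gradingOf_basis_isSuperGrading _ _ ?_ fun x y => ?_
  · rw [coe_mixedBasis]
    refine forall_fin_ten ?_ ?_ ?_ ?_ ?_ ?_ ?_ ?_ ?_ ?_ <;>
      simp [mixedVec_apply, mem_even_iff, mem_odd_iff, bv_apply]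
  · simp only [mixedBasis_repr]
    rw [← ofMixed_toMixed hchar x, ← ofMixed_toMixed hchar y]
    generalize toMixed x = a
    generalize toMixed y = b
    simp only [toMixed_ofMixed hchar]
    refine forall_fin_ten ?_ ?_ ?_ ?_ ?_ ?_ ?_ ?_ ?_ ?_ <;> intro z <;>
    simp +decide only [toMixed_apply, ofMixed_apply, mul_apply_zero, mul_apply_one, mul_apply_two,
      mul_apply_three, mul_apply_four, mul_apply_five, mul_apply_six, mul_apply_seven,
      mul_apply_eight, mul_apply_nine, z, _root_.add_mul, _root_.mul_add, sub_mul, mul_sub] <;> ring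

end K10A

end Kac

namespace Kac

namespace K10A

section Propagation

variable {F G : Type} [Field F] [CommGroup G] {Γ : G → Submodule F (K10A F F)}

variable (F) in
lemma odd_bv_mul :
    K10A.bv F 6 * K10A.bv F 7 = K10A.bv F 1 - (3 * 2⁻¹ ^ 3 : F) • K10A.bv F 0 ∧
    K10A.bv F 6 * K10A.bv F 8 = (2⁻¹ ^ 2 : F) • K10A.bv F 2 ∧
    K10A.bv F 6 * K10A.bv F 9 = (2⁻¹ ^ 2 : F) • K10A.bv F 3 ∧
    K10A.bv F 7 * K10A.bv F 8 = (2⁻¹ ^ 2 : F) • K10A.bv F 4 ∧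
    K10A.bv F 7 * K10A.bv F 9 = (2⁻¹ ^ 2 : F) • K10A.bv F 5 := by
  refine ⟨?_, ?_, ?_, ?_, ?_⟩ <;> apply ext_coord <;>
    simp (decide := true) only [mul_apply_zero, mul_apply_one, mul_apply_two, mul_apply_three,
      mul_apply_four, mul_apply_five, mul_apply_six, mul_apply_seven, mul_apply_eight,
      mul_apply_nine, sub_apply, smul_apply, smul_eq_mul, bv_apply, if_true, if_false] <;> ring

variable (F) in
lemma odd_mixedVec_mul :
    mixedVec F 6 * mixedVec F 7 + mixedVec F 8 * mixedVec F 9 =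
      (2 ^ 2 : F) • mixedVec F 1 - (12 * 2⁻¹ ^ 3 : F) • mixedVec F 0 ∧
    mixedVec F 6 * mixedVec F 7 - mixedVec F 8 * mixedVec F 9 =
      (2 * 2⁻¹ ^ 2 : F) • mixedVec F 2 ∧
    mixedVec F 6 * mixedVec F 9 = (-2⁻¹ ^ 2 : F) • mixedVec F 3 ∧
    mixedVec F 7 * mixedVec F 8 = (-2⁻¹ ^ 2 : F) • mixedVec F 3 ∧
    mixedVec F 6 * mixedVec F 8 = (-2 * 2⁻¹ ^ 2 : F) • mixedVec F 4 ∧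
    mixedVec F 7 * mixedVec F 9 = (-2 * 2⁻¹ ^ 2 : F) • mixedVec F 5 := by
  refine ⟨?_, ?_, ?_, ?_, ?_, ?_⟩ <;> apply ext_coord <;>
    simp (decide := true) only [mixedVec_apply, mul_apply_zero, mul_apply_one, mul_apply_two,
      mul_apply_three, mul_apply_four, mul_apply_five, mul_apply_six, mul_apply_seven,
      mul_apply_eight, mul_apply_nine, add_apply, sub_apply, smul_apply, smul_eq_mul, bv_apply,
      if_true, if_false] <;> ring

variable (hchar : (2 : F) ≠ 0) (hΓ : IsSuperGrading (K10A.even F F F) (K10A.odd F F F) Γ)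

include hchar hΓ

lemma bv_mem_of_odd {g₁ g₂ : G} (h6 : K10A.bv F 6 ∈ Γ g₁) (h7 : K10A.bv F 7 ∈ Γ g₁⁻¹)
    (h8 : K10A.bv F 8 ∈ Γ g₂) (h9 : K10A.bv F 9 ∈ Γ g₂⁻¹) (i : Fin 10) :
    K10A.bv F i ∈ Γ (degFst g₁ g₂ i) := by
  have ht : (2⁻¹ ^ 2 : F) ≠ 0 := pow_ne_zero 2 (inv_ne_zero hchar)
  have h0 := bv_zero_mem hΓ
  have h67 := hΓ.mul_mem h6 h7
  have h68 := hΓ.mul_mem h6 h8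
  have h69 := hΓ.mul_mem h6 h9
  have h78 := hΓ.mul_mem h7 h8
  have h79 := hΓ.mul_mem h7 h9
  obtain ⟨e1, e2, e3, e4, e5⟩ := odd_bv_mul F
  rw [e1, mul_inv_cancel, Submodule.sub_mem_iff_left _ (Submodule.smul_mem _ _ h0)] at h67
  rw [e2, Submodule.smul_mem_iff _ ht] at h68
  rw [e3, Submodule.smul_mem_iff _ ht] at h69
  rw [e4, Submodule.smul_mem_iff _ ht] at h78
  rw [e5, Submodule.smul_mem_iff _ ht] at h79
  revert i
  exact forall_fin_ten h0 h67 h68 h69 h78 h79 h6 h7 h8 h9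

lemma mixedVec_mem_of_odd {g k : G} (h6 : mixedVec F 6 ∈ Γ g) (h7 : mixedVec F 7 ∈ Γ g⁻¹)
    (h8 : mixedVec F 8 ∈ Γ k) (h9 : mixedVec F 9 ∈ Γ k⁻¹) :
    ∃ h, h * h = 1 ∧ ∀ i, mixedVec F i ∈ Γ (degSnd g h i) := by
  have ht : (2⁻¹ ^ 2 : F) ≠ 0 := pow_ne_zero 2 (inv_ne_zero hchar)
  have h0 : mixedVec F 0 ∈ Γ 1 := bv_zero_mem hΓ
  have h67 := hΓ.mul_mem h6 h7
  have h89 := hΓ.mul_mem h8 h9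
  have h69 := hΓ.mul_mem h6 h9
  have h78 := hΓ.mul_mem h7 h8
  have h68 := hΓ.mul_mem h6 h8
  have h79 := hΓ.mul_mem h7 h9
  rw [mul_inv_cancel] at h67 h89
  have h1 := add_mem h67 h89
  have h2 := sub_mem h67 h89
  obtain ⟨e1, e2, e3, e3', e4, e5⟩ := odd_mixedVec_mul F
  rw [e1, Submodule.sub_mem_iff_left _ (Submodule.smul_mem _ _ h0),
    Submodule.smul_mem_iff _ (pow_ne_zero 2 hchar)] at h1
  rw [e2, Submodule.smul_mem_iff _ (mul_ne_zero hchar ht)] at h2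
  rw [e3, Submodule.smul_mem_iff _ (neg_ne_zero.2 ht)] at h69
  rw [e3', Submodule.smul_mem_iff _ (neg_ne_zero.2 ht)] at h78
  rw [e4, Submodule.smul_mem_iff _ (mul_ne_zero (neg_ne_zero.2 hchar) ht)] at h68
  rw [e5, Submodule.smul_mem_iff _ (mul_ne_zero (neg_ne_zero.2 hchar) ht)] at h79
  have hgk : g * k⁻¹ = g⁻¹ * k := hΓ.degree_unique h69 h78 (by
    rw [← coe_mixedBasis hchar]
    exact (mixedBasis hchar).ne_zero 3)
  have hk : g * (g⁻¹ * k) = k := mul_inv_cancel_left g k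
  have hk' : g⁻¹ * (g⁻¹ * k) = k⁻¹ := by rw [← hgk, inv_mul_cancel_left]
  refine ⟨g⁻¹ * k, ?_, ?_⟩
  · nth_rw 1 [← hgk]
    rw [mul_mul_mul_comm, mul_inv_cancel, inv_mul_cancel, one_mul]
  · refine forall_fin_ten h0 h1 h2 h78 ?_ ?_ h6 h7 ?_ ?_
    · change _ ∈ Γ (g * g * (g⁻¹ * k))
      rwa [mul_assoc, hk]
    · change _ ∈ Γ (g⁻¹ * g⁻¹ * (g⁻¹ * k))
      rwa [mul_assoc, hk']
    · change _ ∈ Γ (g * (g⁻¹ * k))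
      rwa [hk]
    · change _ ∈ Γ (g⁻¹ * (g⁻¹ * k))
      rwa [hk']

end Propagation

section Fine

variable {F : Type} [Field F] (hchar : (2 : F) ≠ 0)

include hchar

lemma gamma1_isFine :
    IsFine (K10A.even F F F) (K10A.odd F F F)
      (K10A.gamma1 F (Multiplicative.ofAdd ((1, 0) : ℤ × ℤ))
        (Multiplicative.ofAdd ((0, 1) : ℤ × ℤ))) := by
  have hΓ := gamma1_isSuperGrading (F := F)
  rw [gamma1_eq] at hΓ ⊢
  refine isFine_gradingOf (stdBasis F).linearIndependent hΓ fun H _ Δ hΔ hr => ?_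
  have hmem := hΓ.exists_mem_of_refines (stdBasis F).linearIndependent hΔ hr
  rw [coe_stdBasis] at hmem ⊢
  obtain ⟨g₁, h6⟩ := hmem 6 (by decide)
  obtain ⟨g₁', h7⟩ := hmem 7 (by decide)
  obtain ⟨g₂, h8⟩ := hmem 8 (by decide)
  obtain ⟨g₂', h9⟩ := hmem 9 (by decide)
  have h67 : g₁ * g₁' = 1 := degree_mul_eq_one hchar hΔ true h6 (by simp [mem_odd_iff, bv_apply])
    h7 (by simp [mem_odd_iff, bv_apply])
    (by simp [omega_true, omega_false, omegaLeft, omegaRight, bv_apply])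
  have h89 : g₂ * g₂' = 1 := degree_mul_eq_one hchar hΔ true h8 (by simp [mem_odd_iff, bv_apply])
    h9 (by simp [mem_odd_iff, bv_apply])
    (by simp [omega_true, omega_false, omegaLeft, omegaRight, bv_apply])
  rw [eq_inv_of_mul_eq_one_right h67] at h7
  rw [eq_inv_of_mul_eq_one_right h89] at h9
  refine ⟨degFst g₁ g₂, bv_mem_of_odd hchar hΔ h6 h7 h8 h9, ?_⟩
  have key : ∀ i j : Fin 10, degFst (Multiplicative.ofAdd ((1, 0) : ℤ × ℤ))
      (Multiplicative.ofAdd ((0, 1) : ℤ × ℤ)) i = degFst (Multiplicative.ofAdd ((1, 0) : ℤ × ℤ))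
      (Multiplicative.ofAdd ((0, 1) : ℤ × ℤ)) j →
      i = j ∨ (i = 0 ∨ i = 1) ∧ (j = 0 ∨ j = 1) := by decide
  intro i j hij
  rcases key i j hij with rfl | ⟨rfl | rfl, rfl | rfl⟩ <;> rfl

lemma gamma2_isFine :
    IsFine (K10A.even F F F) (K10A.odd F F F)
      (K10A.gamma2 F (Multiplicative.ofAdd ((1, 0) : ℤ × ZMod 2))
        (Multiplicative.ofAdd ((0, 1) : ℤ × ZMod 2))) := by
  have hΓ := gamma2_isSuperGrading hchar
  have hw : LinearIndependent F (mixedVec F) := by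
    rw [← coe_mixedBasis hchar]
    exact (mixedBasis hchar).linearIndependent
  rw [gamma2_eq] at hΓ ⊢
  refine isFine_gradingOf hw hΓ fun H _ Δ hΔ hr => ?_
  have hmem := hΓ.exists_mem_of_refines hw hΔ hr
  obtain ⟨g, h6⟩ := hmem 6 (by decide)
  obtain ⟨g', h7⟩ := hmem 7 (by decide)
  obtain ⟨k, h8⟩ := hmem 8 (by decide)
  obtain ⟨k', h9⟩ := hmem 9 (by decide)
  have h67 : g * g' = 1 := degree_mul_eq_one hchar hΔ true
    h6 (by simp [mixedVec_apply, mem_odd_iff, bv_apply])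
    h7 (by simp [mixedVec_apply, mem_odd_iff, bv_apply])
    (by simpa [omega_true, omega_false, omegaLeft, omegaRight, mixedVec_apply, bv_apply,
      one_add_one_eq_two] using hchar)
  have h89 : k * k' = 1 := degree_mul_eq_one hchar hΔ true
    h8 (by simp [mixedVec_apply, mem_odd_iff, bv_apply])
    h9 (by simp [mixedVec_apply, mem_odd_iff, bv_apply])
    (by simpa [omega_true, omega_false, omegaLeft, omegaRight, mixedVec_apply, bv_apply,
      one_add_one_eq_two] using hchar)
  rw [eq_inv_of_mul_eq_one_right h67] at h7
  rw [eq_inv_of_mul_eq_one_right h89] at h9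
  obtain ⟨h, -, hdeg⟩ := mixedVec_mem_of_odd hchar hΔ h6 h7 h8 h9
  refine ⟨degSnd g h, hdeg, ?_⟩
  have key : ∀ i j : Fin 10, degSnd (Multiplicative.ofAdd ((1, 0) : ℤ × ZMod 2))
      (Multiplicative.ofAdd ((0, 1) : ℤ × ZMod 2)) i =
      degSnd (Multiplicative.ofAdd ((1, 0) : ℤ × ZMod 2))
      (Multiplicative.ofAdd ((0, 1) : ℤ × ZMod 2)) j →
      i = j ∨ (i = 0 ∨ i = 1 ∨ i = 2) ∧ (j = 0 ∨ j = 1 ∨ j = 2) := by decide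
  intro i j hij
  rcases key i j hij with rfl | ⟨rfl | rfl | rfl, rfl | rfl | rfl⟩ <;> rfl

lemma not_gradEquiv_gamma1_gamma2 :
    ¬ GradEquiv (K10A.even F F F) (K10A.odd F F F)
      (K10A.gamma1 F (Multiplicative.ofAdd ((1, 0) : ℤ × ℤ))
        (Multiplicative.ofAdd ((0, 1) : ℤ × ℤ)))
      (K10A.gamma2 F (Multiplicative.ofAdd ((1, 0) : ℤ × ZMod 2))
        (Multiplicative.ofAdd ((0, 1) : ℤ × ZMod 2))) := by
  rintro ⟨-, α, hα, -⟩
  have h := Nat.card_congr (Equiv.ofBijective α hα)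
  rw [gamma1_eq, gamma2_eq, ← coe_mixedBasis hchar] at h
  simp only [gradingOf_ne_bot_iff (Module.Basis.linearIndependent _)] at h
  have key : ∀ {M : Type} [DecidableEq M] (d : Fin 10 → M),
      Nat.card {g // g ∈ Set.range d} = (Finset.univ.image d).card := fun d => by
    rw [← Set.coe_eq_subtype, Nat.card_coe_set_eq, ← Set.ncard_coe_finset]
    simp
  rw [key, key] at h
  revert h
  decide

end Fine

section Classification

variable {F G : Type} [Field F] [CommGroup G] {Γ : G → Submodule F (K10A F F)}
  (hchar : (2 : F) ≠ 0) (hΓ : IsSuperGrading (K10A.even F F F) (K10A.odd F F F) Γ)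
  (hfine : IsFine (K10A.even F F F) (K10A.odd F F F) Γ)

include hchar hΓ hfine

lemma gradEquiv_gamma1_of_symplectic {m n : K10A F F} {g₁ g₂ : G} (hmn : ∀ c, omega F c m n = 1)
    (h6 : proj F true m ∈ Γ g₁) (h7 : proj F true n ∈ Γ g₁⁻¹)
    (h8 : proj F false m ∈ Γ g₂) (h9 : proj F false n ∈ Γ g₂⁻¹) :
    GradEquiv (K10A.even F F F) (K10A.odd F F F) Γ
      (K10A.gamma1 F (Multiplicative.ofAdd ((1, 0) : ℤ × ℤ))
        (Multiplicative.ofAdd ((0, 1) : ℤ × ℤ))) := by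
  let φ := sympAut m n (hmn true) (hmn false)
  refine hΓ.gradEquiv_of_refines gamma1_isSuperGrading hfine φ ?_
  have hmem : ∀ {x g}, φ.e x ∈ Γ g → x ∈ (Γ g).map φ⁻¹.e.toLinearMap := fun {x g} hx =>
    ⟨φ.e x, hx, φ.e.symm_apply_apply x⟩
  have e6 : φ.e (K10A.bv F 6) = proj F true m := sympAut_bv_six _ _
  have e7 : φ.e (K10A.bv F 7) = proj F true n := sympAut_bv_seven _ _
  have e8 : φ.e (K10A.bv F 8) = proj F false m := sympAut_bv_eight _ _
  have e9 : φ.e (K10A.bv F 9) = proj F false n := sympAut_bv_nine _ _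
  have hdeg := bv_mem_of_odd hchar (hΓ.map φ⁻¹) (g₁ := g₁) (g₂ := g₂)
    (hmem (by rwa [e6])) (hmem (by rwa [e7])) (hmem (by rwa [e8])) (hmem (by rwa [e9]))
  rw [gamma1_eq, coe_stdBasis]
  refine refines_gradingOf φ (fun a => g₁ ^ a.toAdd.1 * g₂ ^ a.toAdd.2) (d' := degFst g₁ g₂)
    (forall_fin_ten ?_ ?_ ?_ ?_ ?_ ?_ ?_ ?_ ?_ ?_) fun i => ?_
  any_goals simp [degFst]
  obtain ⟨y, hy, hyi⟩ := hdeg i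
  rwa [← hyi, show φ.e (φ⁻¹.e.toLinearMap y) = y from φ.e.apply_symm_apply y]

lemma gradEquiv_gamma2_of_symplectic {m n : K10A F F} {g k : G} (hm : m ∈ K10A.odd F F F)
    (hn : n ∈ K10A.odd F F F) (hmn : ∀ c, omega F c m n = 1) (h6 : m ∈ Γ g) (h7 : n ∈ Γ g⁻¹)
    (h8 : proj F true m - proj F false m ∈ Γ k) (h9 : proj F true n - proj F false n ∈ Γ k⁻¹) :
    GradEquiv (K10A.even F F F) (K10A.odd F F F) Γ
      (K10A.gamma2 F (Multiplicative.ofAdd ((1, 0) : ℤ × ZMod 2))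
        (Multiplicative.ofAdd ((0, 1) : ℤ × ZMod 2))) := by
  let φ := sympAut m n (hmn true) (hmn false)
  refine hΓ.gradEquiv_of_refines (gamma2_isSuperGrading hchar) hfine φ ?_
  have hmem : ∀ {x g}, φ.e x ∈ Γ g → x ∈ (Γ g).map φ⁻¹.e.toLinearMap := fun {x g} hx =>
    ⟨φ.e x, hx, φ.e.symm_apply_apply x⟩
  have e6 : φ.e (mixedVec F 6) = m := by
    refine (map_add φ.e _ _).trans (.trans ?_ (proj_add_proj_not true hm))
    exact congrArg₂ _ (sympAut_bv_six _ _) (sympAut_bv_eight _ _)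
  have e7 : φ.e (mixedVec F 7) = n := by
    refine (map_add φ.e _ _).trans (.trans ?_ (proj_add_proj_not true hn))
    exact congrArg₂ _ (sympAut_bv_seven _ _) (sympAut_bv_nine _ _)
  have e8 : φ.e (mixedVec F 8) = proj F true m - proj F false m :=
    (map_sub φ.e _ _).trans (congrArg₂ _ (sympAut_bv_six _ _) (sympAut_bv_eight _ _))
  have e9 : φ.e (mixedVec F 9) = proj F true n - proj F false n :=
    (map_sub φ.e _ _).trans (congrArg₂ _ (sympAut_bv_seven _ _) (sympAut_bv_nine _ _))
  obtain ⟨h, hh, hdeg⟩ := mixedVec_mem_of_odd hchar (hΓ.map φ⁻¹) (g := g) (k := k)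
    (hmem (by rwa [e6])) (hmem (by rwa [e7])) (hmem (by rwa [e8])) (hmem (by rwa [e9]))
  rw [gamma2_eq]
  refine refines_gradingOf φ (fun a => g ^ a.toAdd.1 * h ^ a.toAdd.2.val) (d' := degSnd g h)
    (forall_fin_ten ?_ ?_ ?_ ?_ ?_ ?_ ?_ ?_ ?_ ?_) fun i => ?_
  iterate 10 · simp [degSnd, ZMod.val_one, pow_two]
  obtain ⟨y, hy, hyi⟩ := hdeg i
  rwa [← hyi, show φ.e (φ⁻¹.e.toLinearMap y) = y from φ.e.apply_symm_apply y]

lemma gradEquiv_gamma1_or_gamma2 :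
    GradEquiv (K10A.even F F F) (K10A.odd F F F) Γ
      (K10A.gamma1 F (Multiplicative.ofAdd ((1, 0) : ℤ × ℤ))
        (Multiplicative.ofAdd ((0, 1) : ℤ × ℤ))) ∨
    GradEquiv (K10A.even F F F) (K10A.odd F F F) Γ
      (K10A.gamma2 F (Multiplicative.ofAdd ((1, 0) : ℤ × ZMod 2))
        (Multiplicative.ofAdd ((0, 1) : ℤ × ZMod 2))) := by
  by_cases h : ∀ b p x, x ∈ Γ p → x ∈ K10A.odd F F F → proj F (!b) x = 0 → x = 0
  · obtain ⟨m, n, hm, hn, hmn, g, k, h6, h7, h8, h9⟩ :=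
      exists_symplectic_of_forall_proj_ne_zero hchar hΓ h
    exact Or.inr (gradEquiv_gamma2_of_symplectic hchar hΓ hfine hm hn hmn h6 h7 h8 h9)
  · push Not at h
    obtain ⟨b, p, x, hxp, hx, hx0, hne⟩ := h
    obtain ⟨m, n, hmn⟩ := exists_symplectic_of_proj_not_eq_zero hchar hΓ b hxp hx hx0 hne
    obtain ⟨-, g₁, h6, h7⟩ := hmn true
    obtain ⟨-, g₂, h8, h9⟩ := hmn false
    exact Or.inl (gradEquiv_gamma1_of_symplectic hchar hΓ hfine (fun c => (hmn c).1) h6 h7 h8 h9)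

end Classification
end K10A

end Kac

/-! ### STATEMENT 19 -/

open Kac in
/-- Up to equivalence there are exactly two fine gradings on `K₁₀`:
`Γ¹_{K₁₀}(ℤ²; (1,0), (0,1))` and `Γ²_{K₁₀}(ℤ × ℤ/2; (1,0̄), (0,1̄))`. -/
theorem fine_gradings_on_K10 (F : Type) [Field F] (hchar : (2 : F) ≠ 0) :
    (IsSuperGrading (K10A.even F F F) (K10A.odd F F F)
      (K10A.gamma1 F (Multiplicative.ofAdd ((1, 0) : ℤ × ℤ))
        (Multiplicative.ofAdd ((0, 1) : ℤ × ℤ))) ∧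
     IsFine (K10A.even F F F) (K10A.odd F F F)
      (K10A.gamma1 F (Multiplicative.ofAdd ((1, 0) : ℤ × ℤ))
        (Multiplicative.ofAdd ((0, 1) : ℤ × ℤ)))) ∧
    (IsSuperGrading (K10A.even F F F) (K10A.odd F F F)
      (K10A.gamma2 F (Multiplicative.ofAdd ((1, 0) : ℤ × ZMod 2))
        (Multiplicative.ofAdd ((0, 1) : ℤ × ZMod 2))) ∧
     IsFine (K10A.even F F F) (K10A.odd F F F)
      (K10A.gamma2 F (Multiplicative.ofAdd ((1, 0) : ℤ × ZMod 2))
        (Multiplicative.ofAdd ((0, 1) : ℤ × ZMod 2)))) ∧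
    ¬ GradEquiv (K10A.even F F F) (K10A.odd F F F)
      (K10A.gamma1 F (Multiplicative.ofAdd ((1, 0) : ℤ × ℤ))
        (Multiplicative.ofAdd ((0, 1) : ℤ × ℤ)))
      (K10A.gamma2 F (Multiplicative.ofAdd ((1, 0) : ℤ × ZMod 2))
        (Multiplicative.ofAdd ((0, 1) : ℤ × ZMod 2))) ∧
    (∀ (G : Type) (_ : CommGroup G) (Γ : G → Submodule F (K10A F F)),
      IsSuperGrading (K10A.even F F F) (K10A.odd F F F) Γ →
      IsFine (K10A.even F F F) (K10A.odd F F F) Γ →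
      GradEquiv (K10A.even F F F) (K10A.odd F F F) Γ
        (K10A.gamma1 F (Multiplicative.ofAdd ((1, 0) : ℤ × ℤ))
          (Multiplicative.ofAdd ((0, 1) : ℤ × ℤ))) ∨
      GradEquiv (K10A.even F F F) (K10A.odd F F F) Γ
        (K10A.gamma2 F (Multiplicative.ofAdd ((1, 0) : ℤ × ZMod 2))
          (Multiplicative.ofAdd ((0, 1) : ℤ × ZMod 2)))) :=
  ⟨⟨K10A.gamma1_isSuperGrading, K10A.gamma1_isFine hchar⟩,
    ⟨K10A.gamma2_isSuperGrading hchar, K10A.gamma2_isFine hchar⟩,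
    K10A.not_gradEquiv_gamma1_gamma2 hchar,
    fun _ _ _ hΓ hfine => K10A.gradEquiv_gamma1_or_gamma2 hchar hΓ hfine⟩
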